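/- For any regular LK-proof π of a prenex Σ₁ sequent, with all cut formulas prenex Π₂ or Σ₂, the language L(π) of the associated proof grammar G_π is finite. -/

import Mathlib

set_option maxHeartbeats 1000000

namespace PGram

/-! ### First-order terms and formulas -/

/-- First-order terms: variables, function symbols and application. -/
inductive Term : Type
  | var (n : ℕ)
  | fn (k : ℕ)
  | app (s t : Term)
deriving DecidableEq

instance : Inhabited Term := ⟨.fn 0⟩

/-- Substitution of the variable `v` by the term `t`. -/
def Term.subst (v : ℕ) (t : Term) : Term → Term
  | .var n => if n = v then t else .var n
  | .fn k => .fn k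
  | .app s u => .app (Term.subst v t s) (Term.subst v t u)

/-- Renaming of variables. -/
def Term.ren (ρ : ℕ → ℕ) : Term → Term
  | .var n => .var (ρ n)
  | .fn k => .fn k
  | .app s u => .app (Term.ren ρ s) (Term.ren ρ u)

def Term.vars : Term → List ℕ
  | .var n => [n]
  | .fn _ => []
  | .app s u => s.vars ++ u.vars

/-- Formulas of first-order logic in negation normal form (one-sided calculus). -/
inductive Formula : Type
  | atom (pos : Bool) (P : ℕ) (ts : List Term)
  | or (A B : Formula)
  | and (A B : Formula)
  | all (v : ℕ) (A : Formula)
  | ex (v : ℕ) (A : Formula)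

instance : Inhabited Formula := ⟨.atom true 0 []⟩

/-- The de Morgan dual `Ā` of a formula `A`. -/
def Formula.dual : Formula → Formula
  | .atom b P ts => .atom (!b) P ts
  | .or A B => .and A.dual B.dual
  | .and A B => .or A.dual B.dual
  | .all v A => .ex v A.dual
  | .ex v A => .all v A.dual

/-- Substitution `A(v/t)`. -/
def Formula.subst (v : ℕ) (t : Term) : Formula → Formula
  | .atom b P ts => .atom b P (ts.map (Term.subst v t))
  | .or A B => .or (Formula.subst v t A) (Formula.subst v t B)
  | .and A B => .and (Formula.subst v t A) (Formula.subst v t B)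
  | .all w A => if w = v then .all w A else .all w (Formula.subst v t A)
  | .ex w A => if w = v then .ex w A else .ex w (Formula.subst v t A)

/-- Renaming of all variables of a formula. -/
def Formula.ren (ρ : ℕ → ℕ) : Formula → Formula
  | .atom b P ts => .atom b P (ts.map (Term.ren ρ))
  | .or A B => .or (Formula.ren ρ A) (Formula.ren ρ B)
  | .and A B => .and (Formula.ren ρ A) (Formula.ren ρ B)
  | .all v A => .all (ρ v) (Formula.ren ρ A)
  | .ex v A => .ex (ρ v) (Formula.ren ρ A)

/-- Free variables of a formula. -/
def Formula.fv : Formula → List ℕ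
  | .atom _ _ ts => (ts.map Term.vars).foldr (· ++ ·) []
  | .or A B => A.fv ++ B.fv
  | .and A B => A.fv ++ B.fv
  | .all v A => A.fv.erase v
  | .ex v A => A.fv.erase v

/-- Quantifier-freeness. -/
def Formula.qfB : Formula → Bool
  | .atom .. => true
  | .or A B => A.qfB && B.qfB
  | .and A B => A.qfB && B.qfB
  | .all .. => false
  | .ex .. => false

/-- `∃ v₀ ⋯ ∃ vₖ F`. -/
def Formula.exs (vs : List ℕ) (F : Formula) : Formula := vs.foldr .ex F

/-- `∀ v₀ ⋯ ∀ vₖ F`. -/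
def Formula.alls (vs : List ℕ) (F : Formula) : Formula := vs.foldr .all F

/-- Simultaneous (iterated) substitution of the variables `vs` by the terms `ts`. -/
def Formula.substList (vs : List ℕ) (ts : List Term) (F : Formula) : Formula :=
  (vs.zip ts).foldl (fun A p => A.subst p.1 p.2) F

/-- Propositional (truth-functional) evaluation of a quantifier-free formula
under a valuation of the atoms. -/
def Formula.evalQ (val : ℕ → List Term → Bool) : Formula → Bool
  | .atom b P ts => if b then val P ts else !(val P ts)
  | .or A B => Formula.evalQ val A || Formula.evalQ val B
  | .and A B => Formula.evalQ val A && Formula.evalQ val B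
  | .all _ A => Formula.evalQ val A
  | .ex _ A => Formula.evalQ val A

/-- Number of universal quantifiers in the (prenex) quantifier prefix. -/
def Formula.prefAll : Formula → ℕ
  | .all _ A => A.prefAll + 1
  | .ex _ A => A.prefAll
  | _ => 0

/-- Number of existential quantifiers in the (prenex) quantifier prefix. -/
def Formula.prefEx : Formula → ℕ
  | .ex _ A => A.prefEx + 1
  | .all _ A => A.prefEx
  | _ => 0

/-- Length of the leading block of universal quantifiers. -/
def Formula.allPre : Formula → ℕ
  | .all _ A => A.allPre + 1
  | _ => 0

/-- Length of the leading block of existential quantifiers. -/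
def Formula.exPre : Formula → ℕ
  | .ex _ A => A.exPre + 1
  | _ => 0

def Formula.headAll : Formula → Bool
  | .all .. => true
  | _ => false

def Formula.headEx : Formula → Bool
  | .ex .. => true
  | _ => false

/-- Prenex Σ₁ formulas. -/
inductive Sigma1 : Formula → Prop
  | qf {A} : A.qfB = true → Sigma1 A
  | ex {v A} : Sigma1 A → Sigma1 (.ex v A)

/-- Prenex Π₁ formulas. -/
inductive Pi1 : Formula → Prop
  | qf {A} : A.qfB = true → Pi1 A
  | all {v A} : Pi1 A → Pi1 (.all v A)

/-- Prenex Π₂ formulas. -/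
inductive Pi2 : Formula → Prop
  | sig {A} : Sigma1 A → Pi2 A
  | all {v A} : Pi2 A → Pi2 (.all v A)

/-- Prenex Σ₂ formulas. -/
inductive Sigma2 : Formula → Prop
  | pi {A} : Pi1 A → Sigma2 A
  | ex {v A} : Sigma2 A → Sigma2 (.ex v A)

/-- Genuine prenex Π₂ formulas (not already Σ₂, i.e. with a ∀ properly before an ∃). -/
def GenuinePi2 (F : Formula) : Prop := Pi2 F ∧ ¬ Sigma2 F

/-- Universally quantified Π₂ formulas. -/
def UnivPi2 (F : Formula) : Prop := Pi2 F ∧ F.headAll = true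

end PGram
namespace PGram

/-! ### The one-sided sequent calculus LK -/

/-- Sequents: finite sequences of formulas. -/
abbrev Sequent := List Formula

/-- One-sided (Tait-style) sequent calculus LK with explicit weakening,
contraction and (adjacent) permutation. -/
inductive LK : Sequent → Type
  | ax (b : Bool) (P : ℕ) (ts : List Term) : LK [.atom b P ts, .atom (!b) P ts]
  | orI (A B : Formula) (Γ : Sequent) : LK (A :: B :: Γ) → LK (.or A B :: Γ)
  | andI (A B : Formula) (Γ Δ : Sequent) : LK (A :: Γ) → LK (B :: Δ) → LK (.and A B :: (Γ ++ Δ))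
  | allI (v α : ℕ) (A : Formula) (Γ : Sequent) :
      LK (A.subst v (.var α) :: Γ) → LK (.all v A :: Γ)
  | exI (v : ℕ) (t : Term) (A : Formula) (Γ : Sequent) :
      LK (A.subst v t :: Γ) → LK (.ex v A :: Γ)
  | cut (A : Formula) (Γ Δ : Sequent) : LK (A :: Γ) → LK (A.dual :: Δ) → LK (Γ ++ Δ)
  | wk (A : Formula) (Γ : Sequent) : LK Γ → LK (A :: Γ)
  | ctr (A : Formula) (Γ : Sequent) : LK (A :: A :: Γ) → LK (A :: Γ)
  | perm (A B : Formula) (Γ Δ : Sequent) : LK (Γ ++ B :: A :: Δ) → LK (Γ ++ A :: B :: Δ)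

/-- A proof together with its end sequent. -/
def PProof : Type := Σ Γ : Sequent, LK Γ

/-- Transport of a proof along an equality of sequents. -/
def LK.castSeq {Γ Δ : Sequent} (h : Γ = Δ) (p : LK Γ) : LK Δ := h ▸ p

/-- Moving a formula leftwards across a block `Λ` (a sequence of permutations). -/
def LK.hoist (A : Formula) (Λ : Sequent) :
    ∀ (Ξ Θ : Sequent), LK (Ξ ++ (Λ ++ A :: Θ)) → LK (Ξ ++ A :: (Λ ++ Θ)) :=
  List.reverseRecOn
    (motive := fun Λ => ∀ (Ξ Θ : Sequent), LK (Ξ ++ (Λ ++ A :: Θ)) → LK (Ξ ++ A :: (Λ ++ Θ)))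
    Λ (fun _ _ p => p)
    (fun Λ' C ih Ξ Θ p =>
      LK.castSeq (by simp)
        (ih Ξ (C :: Θ) (LK.castSeq (by simp) (LK.perm A C (Ξ ++ Λ') Θ (LK.castSeq (by simp) p)))))

/-- Moving a formula rightwards across a block `Λ` (a sequence of permutations). -/
def LK.plunge (A : Formula) : ∀ (Λ Ξ Θ : Sequent), LK (Ξ ++ A :: (Λ ++ Θ)) → LK (Ξ ++ (Λ ++ A :: Θ))
  | [], _, _, p => p
  | C :: Λ', Ξ, Θ, p =>
      LK.castSeq (by simp)
        (LK.plunge A Λ' (Ξ ++ [C]) Θ (LK.castSeq (by simp) (LK.perm C A Ξ (Λ' ++ Θ) p)))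

/-- Pull a formula to the front of the sequent. -/
def LK.pull (A : Formula) (Λ : Sequent) {Θ : Sequent} (p : LK (Λ ++ A :: Θ)) :
    LK (A :: (Λ ++ Θ)) :=
  LK.hoist A Λ [] Θ p

/-- Push the front formula into the sequent. -/
def LK.push (A : Formula) (Λ : Sequent) {Θ : Sequent} (p : LK (A :: (Λ ++ Θ))) :
    LK (Λ ++ A :: Θ) :=
  LK.plunge A Λ [] Θ p

/-- Bring the last formula to the front. -/
def LK.toFront (A : Formula) (Γ : Sequent) (p : LK (Γ ++ [A])) : LK (A :: Γ) :=
  LK.castSeq (by simp) (LK.pull A Γ (Θ := []) p)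

/-- Bring the front formula to the end. -/
def LK.toEnd (A : Formula) (Γ : Sequent) (p : LK (A :: Γ)) : LK (Γ ++ [A]) :=
  LK.push A Γ (Θ := []) (LK.castSeq (by simp) p)

/-- Exchange two blocks (a sequence of permutations). -/
def LK.swapBlk : ∀ (Δ Γ Λ : Sequent), LK (Γ ++ (Λ ++ Δ)) → LK (Γ ++ (Δ ++ Λ))
  | [], Γ, Λ, p => LK.castSeq (by simp) p
  | B :: Δ', Γ, Λ, p =>
      LK.castSeq (by simp)
        (LK.swapBlk Δ' (Γ ++ [B]) Λ (LK.castSeq (by simp) (LK.hoist B Λ Γ Δ' p)))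

/-- Contract a duplicated block `Δ` (the rule `c*`). -/
def LK.ctrBlock : ∀ (Δ Γ : Sequent), LK (Γ ++ (Δ ++ Δ)) → LK (Γ ++ Δ)
  | [], Γ, p => LK.castSeq (by simp) p
  | B :: Δ', Γ, p =>
      let p1 : LK (B :: (Γ ++ (Δ' ++ B :: Δ'))) := LK.pull B Γ (Θ := Δ' ++ B :: Δ') p
      let p2 : LK ((B :: (Γ ++ Δ')) ++ B :: Δ') := LK.castSeq (by simp) p1
      let p3 : LK (B :: ((B :: (Γ ++ Δ')) ++ Δ')) := LK.pull B (B :: (Γ ++ Δ')) (Θ := Δ') p2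
      let p4 : LK (B :: ((Γ ++ Δ') ++ Δ')) := LK.ctr B ((Γ ++ Δ') ++ Δ') p3
      let p5 : LK ((B :: Γ) ++ (Δ' ++ Δ')) := LK.castSeq (by simp) p4
      let p6 : LK ((B :: Γ) ++ Δ') := LK.ctrBlock Δ' (B :: Γ) p5
      LK.push B Γ (Θ := Δ') p6

/-- Weakening by a whole sequent `Δ` (the rule `w*`). -/
def LK.wkEnd : ∀ (Δ : Sequent) {Γ : Sequent}, LK Γ → LK (Γ ++ Δ)
  | [], _, p => LK.castSeq (by simp) p
  | B :: Δ', Γ, p => LK.castSeq (by simp) (LK.wkEnd Δ' (LK.toEnd B Γ (LK.wk B Γ p)))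

/-- The eigenvariables of the strong quantifier inferences of a proof. -/
def LK.eigenVars : {Γ : Sequent} → LK Γ → List ℕ
  | _, .ax .. => []
  | _, .orI _ _ _ p => p.eigenVars
  | _, .andI _ _ _ _ p q => p.eigenVars ++ q.eigenVars
  | _, .allI _ α _ _ p => α :: p.eigenVars
  | _, .exI _ _ _ _ p => p.eigenVars
  | _, .cut _ _ _ p q => p.eigenVars ++ q.eigenVars
  | _, .wk _ _ p => p.eigenVars
  | _, .ctr _ _ p => p.eigenVars
  | _, .perm _ _ _ _ p => p.eigenVars

/-- The cut formulas occurring in a proof. -/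
def LK.cutFormulas : {Γ : Sequent} → LK Γ → List Formula
  | _, .ax .. => []
  | _, .orI _ _ _ p => p.cutFormulas
  | _, .andI _ _ _ _ p q => p.cutFormulas ++ q.cutFormulas
  | _, .allI _ _ _ _ p => p.cutFormulas
  | _, .exI _ _ _ _ p => p.cutFormulas
  | _, .cut A _ _ p q => A :: (p.cutFormulas ++ q.cutFormulas)
  | _, .wk _ _ p => p.cutFormulas
  | _, .ctr _ _ p => p.cutFormulas
  | _, .perm _ _ _ _ p => p.cutFormulas

/-- Cut-freeness of a proof. -/
def LK.CutFree {Γ : Sequent} (p : LK Γ) : Prop := p.cutFormulas = []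

/-- All cut formulas are prenex Ξ₂ or Σ₂. -/
def LK.CutsPi2Sigma2 {Γ : Sequent} (p : LK Γ) : Prop :=
  ∀ A ∈ p.cutFormulas, Pi2 A ∨ Sigma2 A

/-- No contraction inference on the formula `C` occurs in the proof. -/
def LK.noCtrOn (C : Formula) : {Γ : Sequent} → LK Γ → Prop
  | _, .ax .. => True
  | _, .orI _ _ _ p => p.noCtrOn C
  | _, .andI _ _ _ _ p q => p.noCtrOn C ∧ q.noCtrOn C
  | _, .allI _ _ _ _ p => p.noCtrOn C
  | _, .exI _ _ _ _ p => p.noCtrOn C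
  | _, .cut _ _ _ p q => p.noCtrOn C ∧ q.noCtrOn C
  | _, .wk _ _ p => p.noCtrOn C
  | _, .ctr A _ p => A ≠ C ∧ p.noCtrOn C
  | _, .perm _ _ _ _ p => p.noCtrOn C

/-- Free variables of a sequent. -/
def seqFv (Γ : Sequent) : List ℕ := (Γ.map Formula.fv).foldr (· ++ ·) []

/-- Regularity: each strong quantifier inference has a unique eigenvariable,
and eigenvariables satisfy the eigenvariable condition. -/
def LK.Regular : {Γ : Sequent} → LK Γ → Prop
  | _, .ax .. => True
  | _, .orI _ _ _ p => p.Regular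
  | _, .andI _ _ _ _ p q => p.Regular ∧ q.Regular ∧ p.eigenVars.Disjoint q.eigenVars
  | _, .allI v α A Γ p => α ∉ seqFv (.all v A :: Γ) ∧ α ∉ p.eigenVars ∧ p.Regular
  | _, .exI _ _ _ _ p => p.Regular
  | _, .cut _ _ _ p q => p.Regular ∧ q.Regular ∧ p.eigenVars.Disjoint q.eigenVars
  | _, .wk _ _ p => p.Regular
  | _, .ctr _ _ p => p.Regular
  | _, .perm _ _ _ _ p => p.Regular

end PGram
namespace PGram

/-! ### The proof grammar -/

/-- Structured λ-terms of the proof grammar: de Bruijn bound variables, free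
variables (eigenvariables), first-order function symbols, the empty sequence
`⟨⟩`, application, abstraction, pairing `⋆`, explicit substitution `s[α ↦ t]`,
non-terminals `σ_π^i`, and pair projections (for the context-free variant). -/
inductive GTerm : Type
  | bvar (n : ℕ)
  | fvar (n : ℕ)
  | fn (k : ℕ)
  | unit
  | app (s t : GTerm)
  | lam (s : GTerm)
  | pair (s t : GTerm)
  | esub (s : GTerm) (α : ℕ) (t : GTerm)
  | nt (p : PProof) (i : ℕ)
  | pr0 (s : GTerm)
  | pr1 (s : GTerm)

/-- Iterated application. -/
def GTerm.apps (h : GTerm) (l : List GTerm) : GTerm := l.foldl GTerm.app h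

/-- Embedding of first-order terms into grammar terms. -/
def Term.toG : Term → GTerm
  | .var n => .fvar n
  | .fn k => .fn k
  | .app s t => .app s.toG t.toG

/-- de Bruijn shifting. -/
def GTerm.shift (d : ℕ) : ℕ → GTerm → GTerm
  | k, .bvar n => if n < k then .bvar n else .bvar (n + d)
  | _, .fvar n => .fvar n
  | _, .fn m => .fn m
  | _, .unit => .unit
  | k, .app s t => .app (GTerm.shift d k s) (GTerm.shift d k t)
  | k, .lam s => .lam (GTerm.shift d (k + 1) s)
  | k, .pair s t => .pair (GTerm.shift d k s) (GTerm.shift d k t)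
  | k, .esub s α t => .esub (GTerm.shift d k s) α (GTerm.shift d k t)
  | _, .nt p i => .nt p i
  | k, .pr0 s => .pr0 (GTerm.shift d k s)
  | k, .pr1 s => .pr1 (GTerm.shift d k s)

/-- de Bruijn instantiation (β-substitution of bound variable `k` by `u`). -/
def GTerm.instB (u : GTerm) : ℕ → GTerm → GTerm
  | k, .bvar n => if n = k then GTerm.shift k 0 u else if k < n then .bvar (n - 1) else .bvar n
  | _, .fvar n => .fvar n
  | _, .fn m => .fn m
  | _, .unit => .unit
  | k, .app s t => .app (GTerm.instB u k s) (GTerm.instB u k t)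
  | k, .lam s => .lam (GTerm.instB u (k + 1) s)
  | k, .pair s t => .pair (GTerm.instB u k s) (GTerm.instB u k t)
  | k, .esub s α t => .esub (GTerm.instB u k s) α (GTerm.instB u k t)
  | _, .nt p i => .nt p i
  | k, .pr0 s => .pr0 (GTerm.instB u k s)
  | k, .pr1 s => .pr1 (GTerm.instB u k s)

/-- Substitution of the free variable `α` by `u`. -/
def GTerm.substF (α : ℕ) (u : GTerm) : GTerm → GTerm
  | .bvar n => .bvar n
  | .fvar n => if n = α then u else .fvar n
  | .fn m => .fn m
  | .unit => .unit
  | .app s t => .app (GTerm.substF α u s) (GTerm.substF α u t)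
  | .lam s => .lam (GTerm.substF α u s)
  | .pair s t => .pair (GTerm.substF α u s) (GTerm.substF α u t)
  | .esub s β t => .esub (GTerm.substF α u s) β (GTerm.substF α u t)
  | .nt p i => .nt p i
  | .pr0 s => .pr0 (GTerm.substF α u s)
  | .pr1 s => .pr1 (GTerm.substF α u s)

/-- Evaluation `T ↦ T*` of all explicit substitutions. -/
def GTerm.evalE : GTerm → GTerm
  | .bvar n => .bvar n
  | .fvar n => .fvar n
  | .fn m => .fn m
  | .unit => .unit
  | .app s t => .app s.evalE t.evalE
  | .lam s => .lam s.evalE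
  | .pair s t => .pair s.evalE t.evalE
  | .esub s α t => GTerm.substF α t.evalE s.evalE
  | .nt p i => .nt p i
  | .pr0 s => .pr0 s.evalE
  | .pr1 s => .pr1 s.evalE

/-- Reading back a (non-terminal free, substitution free) grammar term as a
first-order term. -/
def GTerm.toFOT : GTerm → Option Term
  | .fvar n => some (.var n)
  | .fn k => some (.fn k)
  | .app s t => do
      let s' ← s.toFOT
      let t' ← t.toFOT
      pure (.app s' t')
  | _ => none

/-- Reading back a sequence-term `⟨t₁,…,tₖ⟩` as a list of first-order terms. -/
def GTerm.toSeq : GTerm → Option (List Term)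
  | .unit => some []
  | .pair s t => do
      let s' ← s.toFOT
      let t' ← t.toSeq
      pure (s' :: t')
  | _ => none

/-- `m`-fold λ-abstraction. -/
def GTerm.lams : ℕ → GTerm → GTerm
  | 0, b => b
  | m + 1, b => .lam (GTerm.lams m b)

/-- The sequence-term `⟨z₀,…,z_{m-1}⟩` of the bound variables of `m` enclosing
abstractions. -/
def GTerm.varSeq (m : ℕ) : GTerm :=
  (List.range m).reverse.foldr (fun j acc => .pair (.bvar j) acc) .unit

/-- The sequence-term `⟨c,…,c⟩` (`k` copies) of a fixed constant, written `c_A`. -/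
def GTerm.constSeq (k : ℕ) : GTerm :=
  (List.range k).foldr (fun _ acc => .pair (.fn 0) acc) .unit

/-- The composition operation `(σ_p⁰ ∘_F σ_q⁰) x̄ ȳ` of the cut production rules. -/
def comp (F : Formula) (p q : PProof) (xs ys : List GTerm) : GTerm :=
  if F.qfB then .unit
  else if F.headAll then
    .lams F.allPre
      (GTerm.apps (.nt p 0) (GTerm.varSeq F.allPre :: xs.map (GTerm.shift F.allPre 0)))
  else
    GTerm.apps (.nt p 0)
      ((GTerm.lams F.exPre
          (GTerm.apps (.nt q 0) (GTerm.varSeq F.exPre :: ys.map (GTerm.shift F.exPre 0)))) :: xs)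

/-- One-step rewriting of the proof grammar: production rules (determined by
the last inference of the indexing proof), β-reduction and congruence closure.
The parameter `cf` selects the context-free variant of the `∀`-production rule
(via pair projections). -/
inductive Step (cf : Bool) : GTerm → GTerm → Prop
  -- β-reduction and computation rules
  | beta (s t : GTerm) : Step cf (.app (.lam s) t) (GTerm.instB t 0 s)
  | unitApp (t : GTerm) : Step cf (.app .unit t) .unit
  | proj0 (s t : GTerm) : Step cf (.pr0 (.pair s t)) s
  | proj1 (s t : GTerm) : Step cf (.pr1 (.pair s t)) t
  -- congruence closure
  | appL {s s'} (t : GTerm) : Step cf s s' → Step cf (.app s t) (.app s' t)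
  | appR (s : GTerm) {t t'} : Step cf t t' → Step cf (.app s t) (.app s t')
  | lamC {s s'} : Step cf s s' → Step cf (.lam s) (.lam s')
  | pairL {s s'} (t : GTerm) : Step cf s s' → Step cf (.pair s t) (.pair s' t)
  | pairR (s : GTerm) {t t'} : Step cf t t' → Step cf (.pair s t) (.pair s t')
  | esubL {s s'} (α : ℕ) (t : GTerm) : Step cf s s' → Step cf (.esub s α t) (.esub s' α t)
  | esubR (s : GTerm) (α : ℕ) {t t'} : Step cf t t' → Step cf (.esub s α t) (.esub s α t')
  | pr0C {s s'} : Step cf s s' → Step cf (.pr0 s) (.pr0 s')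
  | pr1C {s s'} : Step cf s s' → Step cf (.pr1 s) (.pr1 s')
  -- production rules (cf. Table 2)
  | ax0 (b P ts) (z₀ z₁ : GTerm) :
      Step cf (GTerm.apps (.nt ⟨_, LK.ax b P ts⟩ 0) [z₀, z₁]) z₁
  | ax1 (b P ts) (z₀ z₁ : GTerm) :
      Step cf (GTerm.apps (.nt ⟨_, LK.ax b P ts⟩ 1) [z₀, z₁]) z₀
  | orI0 {A B Γ} (p : LK (A :: B :: Γ)) (z : GTerm) (ys : List GTerm)
      (hy : ys.length = Γ.length) :
      Step cf (GTerm.apps (.nt ⟨_, LK.orI A B Γ p⟩ 0) (z :: ys)) .unit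
  | orIS {A B Γ} (p : LK (A :: B :: Γ)) (i : ℕ) (z : GTerm) (ys : List GTerm)
      (hy : ys.length = Γ.length) :
      Step cf (GTerm.apps (.nt ⟨_, LK.orI A B Γ p⟩ (i + 1)) (z :: ys))
        (GTerm.apps (.nt ⟨_, p⟩ (i + 2)) (.unit :: .unit :: ys))
  | andI0 {A B Γ Δ} (p : LK (A :: Γ)) (q : LK (B :: Δ)) (z : GTerm) (xs ys : List GTerm)
      (hx : xs.length = Γ.length) (hy : ys.length = Δ.length) :
      Step cf (GTerm.apps (.nt ⟨_, LK.andI A B Γ Δ p q⟩ 0) (z :: (xs ++ ys))) .unit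
  | andIL {A B Γ Δ} (p : LK (A :: Γ)) (q : LK (B :: Δ)) (i : ℕ) (z : GTerm)
      (xs ys : List GTerm) (hx : xs.length = Γ.length) (hy : ys.length = Δ.length)
      (hi : i < Γ.length) :
      Step cf (GTerm.apps (.nt ⟨_, LK.andI A B Γ Δ p q⟩ (i + 1)) (z :: (xs ++ ys)))
        (GTerm.apps (.nt ⟨_, p⟩ (i + 1)) (.unit :: xs))
  | andIR {A B Γ Δ} (p : LK (A :: Γ)) (q : LK (B :: Δ)) (i : ℕ) (z : GTerm)
      (xs ys : List GTerm) (hx : xs.length = Γ.length) (hy : ys.length = Δ.length)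
      (hi : Γ.length ≤ i) :
      Step cf (GTerm.apps (.nt ⟨_, LK.andI A B Γ Δ p q⟩ (i + 1)) (z :: (xs ++ ys)))
        (GTerm.apps (.nt ⟨_, q⟩ (i - Γ.length + 1)) (.unit :: ys))
  | allP {v α A Γ} (p : LK (A.subst v (.var α) :: Γ)) (i : ℕ) (z₀ z₁ : GTerm)
      (ys : List GTerm) (hy : ys.length = Γ.length) (hcf : cf = false) :
      Step cf (GTerm.apps (.nt ⟨_, LK.allI v α A Γ p⟩ i) (.pair z₀ z₁ :: ys))
        (.esub (GTerm.apps (.nt ⟨_, p⟩ i) (z₁ :: ys)) α z₀)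
  | allPcf {v α A Γ} (p : LK (A.subst v (.var α) :: Γ)) (i : ℕ) (z : GTerm)
      (ys : List GTerm) (hy : ys.length = Γ.length) (hcf : cf = true) :
      Step cf (GTerm.apps (.nt ⟨_, LK.allI v α A Γ p⟩ i) (z :: ys))
        (.esub (GTerm.apps (.nt ⟨_, p⟩ i) (.pr1 z :: ys)) α (.pr0 z))
  | exI0 {v t A Γ} (p : LK (A.subst v t :: Γ)) (z : GTerm) (ys : List GTerm)
      (hy : ys.length = Γ.length) :
      Step cf (GTerm.apps (.nt ⟨_, LK.exI v t A Γ p⟩ 0) (z :: ys))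
        (.pair t.toG (GTerm.apps (.nt ⟨_, p⟩ 0) (.app z t.toG :: ys)))
  | exIS {v t A Γ} (p : LK (A.subst v t :: Γ)) (i : ℕ) (z : GTerm) (ys : List GTerm)
      (hy : ys.length = Γ.length) :
      Step cf (GTerm.apps (.nt ⟨_, LK.exI v t A Γ p⟩ (i + 1)) (z :: ys))
        (GTerm.apps (.nt ⟨_, p⟩ (i + 1)) (.app z t.toG :: ys))
  | cutL {A Γ Δ} (p : LK (A :: Γ)) (q : LK (A.dual :: Δ)) (i : ℕ) (xs ys : List GTerm)
      (hx : xs.length = Γ.length) (hy : ys.length = Δ.length) (hi : i < Γ.length) :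
      Step cf (GTerm.apps (.nt ⟨_, LK.cut A Γ Δ p q⟩ i) (xs ++ ys))
        (GTerm.apps (.nt ⟨_, p⟩ (i + 1)) (comp A.dual ⟨_, q⟩ ⟨_, p⟩ ys xs :: xs))
  | cutR {A Γ Δ} (p : LK (A :: Γ)) (q : LK (A.dual :: Δ)) (i : ℕ) (xs ys : List GTerm)
      (hx : xs.length = Γ.length) (hy : ys.length = Δ.length) (hi : Γ.length ≤ i) :
      Step cf (GTerm.apps (.nt ⟨_, LK.cut A Γ Δ p q⟩ i) (xs ++ ys))
        (GTerm.apps (.nt ⟨_, q⟩ (i - Γ.length + 1)) (comp A ⟨_, p⟩ ⟨_, q⟩ xs ys :: ys))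
  | ctr0a {A Γ} (p : LK (A :: A :: Γ)) (z : GTerm) (ys : List GTerm)
      (hy : ys.length = Γ.length) :
      Step cf (GTerm.apps (.nt ⟨_, LK.ctr A Γ p⟩ 0) (z :: ys))
        (GTerm.apps (.nt ⟨_, p⟩ 0) (z :: z :: ys))
  | ctr0b {A Γ} (p : LK (A :: A :: Γ)) (z : GTerm) (ys : List GTerm)
      (hy : ys.length = Γ.length) :
      Step cf (GTerm.apps (.nt ⟨_, LK.ctr A Γ p⟩ 0) (z :: ys))
        (GTerm.apps (.nt ⟨_, p⟩ 1) (z :: z :: ys))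
  | ctrS {A Γ} (p : LK (A :: A :: Γ)) (i : ℕ) (z : GTerm) (ys : List GTerm)
      (hy : ys.length = Γ.length) :
      Step cf (GTerm.apps (.nt ⟨_, LK.ctr A Γ p⟩ (i + 1)) (z :: ys))
        (GTerm.apps (.nt ⟨_, p⟩ (i + 2)) (z :: z :: ys))
  | wk0 {A Γ} (p : LK Γ) (z : GTerm) (ys : List GTerm) (hy : ys.length = Γ.length) :
      Step cf (GTerm.apps (.nt ⟨_, LK.wk A Γ p⟩ 0) (z :: ys)) (GTerm.constSeq A.prefEx)
  | wkS {A Γ} (p : LK Γ) (i : ℕ) (z : GTerm) (ys : List GTerm)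
      (hy : ys.length = Γ.length) :
      Step cf (GTerm.apps (.nt ⟨_, LK.wk A Γ p⟩ (i + 1)) (z :: ys))
        (GTerm.apps (.nt ⟨_, p⟩ i) ys)
  | permP {A B Γ Δ} (p : LK (Γ ++ B :: A :: Δ)) (i : ℕ) (xs : List GTerm)
      (z₀ z₁ : GTerm) (ys : List GTerm) (hx : xs.length = Γ.length)
      (hy : ys.length = Δ.length) :
      Step cf (GTerm.apps (.nt ⟨_, LK.perm A B Γ Δ p⟩ i) (xs ++ z₀ :: z₁ :: ys))
        (GTerm.apps
          (.nt ⟨_, p⟩ (if i = Γ.length then i + 1 else if i = Γ.length + 1 then i - 1 else i))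
          (xs ++ z₁ :: z₀ :: ys))

/-- Normal forms of the grammar rewriting relation. -/
def NormalForm (cf : Bool) (u : GTerm) : Prop := ∀ v, ¬ Step cf u v

/-- The language of a grammar term: the set of terms derivable from it to
which no further rules apply. -/
def LangT (cf : Bool) (u : GTerm) : Set GTerm :=
  {v | Relation.ReflTransGen (Step cf) u v ∧ NormalForm cf v}

/-- The start term `σ_π^i ⟨⟩ ⋯ ⟨⟩`. -/
def startTerm (p : PProof) (i : ℕ) : GTerm :=
  GTerm.apps (.nt p i) (List.replicate p.1.length .unit)

/-- The language `L(π)` of the proof grammar `G_π`: all pairs `(i, T*)` of an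
end-sequent index and the evaluated tuple of first-order witness terms of a
non-terminal-free sequence-term `T` derivable from `σ_π^i ⟨⟩ ⋯ ⟨⟩`. -/
def LangP (cf : Bool) (p : PProof) : Set (ℕ × List Term) :=
  {x | x.1 < p.1.length ∧ ∃ T ∈ LangT cf (startTerm p x.1), T.evalE.toSeq = some x.2}

/-- The language of the proof grammar `G_π`. -/
def L (p : PProof) : Set (ℕ × List Term) := LangP false p

/-- The language of the context-free variant `G'_π` of the proof grammar. -/
def L' (p : PProof) : Set (ℕ × List Term) := LangP true p

end PGram
namespace PGram

/-! ### Herbrand sets -/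

/-- The Herbrand set of a proof of a prenex Σ₁ sequent: the set of pairs
`(i, t̄)` of instance tuples of the existential quantifier block of the `i`-th
end-sequent formula, as the witnesses appear in the proof. -/
def LK.herbrand : {Γ : Sequent} → LK Γ → Set (ℕ × List Term)
  | _, .ax .. => {x | (x.1 = 0 ∨ x.1 = 1) ∧ x.2 = []}
  | _, .orI _ _ _ p =>
      {x | (x.1 = 0 ∧ x.2 = []) ∨ (0 < x.1 ∧ (x.1 + 1, x.2) ∈ p.herbrand)}
  | _, .andI _ _ Γ _ p q =>
      {x | (x.1 = 0 ∧ x.2 = []) ∨ (0 < x.1 ∧ x.1 ≤ Γ.length ∧ (x.1, x.2) ∈ p.herbrand) ∨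
        (Γ.length < x.1 ∧ (x.1 - Γ.length, x.2) ∈ q.herbrand)}
  | _, .allI _ _ _ _ p => p.herbrand
  | _, .exI _ t _ _ p =>
      {x | (x.1 = 0 ∧ ∃ ts, x.2 = t :: ts ∧ (0, ts) ∈ p.herbrand) ∨
        (0 < x.1 ∧ (x.1, x.2) ∈ p.herbrand)}
  | _, .cut _ Γ _ p q =>
      {x | (x.1 < Γ.length ∧ (x.1 + 1, x.2) ∈ p.herbrand) ∨
        (Γ.length ≤ x.1 ∧ (x.1 - Γ.length + 1, x.2) ∈ q.herbrand)}
  | _, .wk _ _ p => {x | 0 < x.1 ∧ (x.1 - 1, x.2) ∈ p.herbrand}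
  | _, .ctr _ _ p =>
      {x | (x.1 = 0 ∧ ((0, x.2) ∈ p.herbrand ∨ (1, x.2) ∈ p.herbrand)) ∨
        (0 < x.1 ∧ (x.1 + 1, x.2) ∈ p.herbrand)}
  | _, .perm _ _ Γ _ p =>
      {x | (x.1 = Γ.length ∧ (x.1 + 1, x.2) ∈ p.herbrand) ∨
        (x.1 = Γ.length + 1 ∧ (x.1 - 1, x.2) ∈ p.herbrand) ∨
        (x.1 ≠ Γ.length ∧ x.1 ≠ Γ.length + 1 ∧ (x.1, x.2) ∈ p.herbrand)}

/-! ### Substitution and renaming of proofs -/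

/-- `VSub α t π π'` expresses that `π'` is the result `π[α ↦ t]` of replacing
the (eigen)variable `α` by the term `t` throughout the proof `π`. -/
inductive VSub (α : ℕ) (t : Term) : {Γ Δ : Sequent} → LK Γ → LK Δ → Prop
  | ax (b P ts) : VSub α t (.ax b P ts) (.ax b P (ts.map (Term.subst α t)))
  | orI {A B Γ A' B' Γ'} (p : LK (A :: B :: Γ)) (p' : LK (A' :: B' :: Γ'))
      (hA : A' = A.subst α t) (hB : B' = B.subst α t)
      (hΓ : Γ' = Γ.map (Formula.subst α t)) (h : VSub α t p p') :
      VSub α t (.orI A B Γ p) (.orI A' B' Γ' p')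
  | andI {A B Γ Δ A' B' Γ' Δ'} (p : LK (A :: Γ)) (q : LK (B :: Δ))
      (p' : LK (A' :: Γ')) (q' : LK (B' :: Δ'))
      (hA : A' = A.subst α t) (hB : B' = B.subst α t)
      (hΓ : Γ' = Γ.map (Formula.subst α t)) (hΔ : Δ' = Δ.map (Formula.subst α t))
      (hp : VSub α t p p') (hq : VSub α t q q') :
      VSub α t (.andI A B Γ Δ p q) (.andI A' B' Γ' Δ' p' q')
  | allI {v β A Γ A' Γ'} (p : LK (A.subst v (.var β) :: Γ))
      (p' : LK (A'.subst v (.var β) :: Γ')) (hβ : β ≠ α)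
      (hA : A' = A.subst α t) (hΓ : Γ' = Γ.map (Formula.subst α t))
      (h : VSub α t p p') : VSub α t (.allI v β A Γ p) (.allI v β A' Γ' p')
  | exI {v r A Γ A' Γ'} (p : LK (A.subst v r :: Γ))
      (p' : LK (A'.subst v (r.subst α t) :: Γ'))
      (hA : A' = A.subst α t) (hΓ : Γ' = Γ.map (Formula.subst α t))
      (h : VSub α t p p') : VSub α t (.exI v r A Γ p) (.exI v (r.subst α t) A' Γ' p')
  | cut {A Γ Δ A' Γ' Δ'} (p : LK (A :: Γ)) (q : LK (A.dual :: Δ))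
      (p' : LK (A' :: Γ')) (q' : LK (A'.dual :: Δ'))
      (hA : A' = A.subst α t) (hΓ : Γ' = Γ.map (Formula.subst α t))
      (hΔ : Δ' = Δ.map (Formula.subst α t))
      (hp : VSub α t p p') (hq : VSub α t q q') :
      VSub α t (.cut A Γ Δ p q) (.cut A' Γ' Δ' p' q')
  | wk {A Γ A' Γ'} (p : LK Γ) (p' : LK Γ')
      (hA : A' = A.subst α t) (hΓ : Γ' = Γ.map (Formula.subst α t))
      (h : VSub α t p p') : VSub α t (.wk A Γ p) (.wk A' Γ' p')
  | ctr {A Γ A' Γ'} (p : LK (A :: A :: Γ)) (p' : LK (A' :: A' :: Γ'))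
      (hA : A' = A.subst α t) (hΓ : Γ' = Γ.map (Formula.subst α t))
      (h : VSub α t p p') : VSub α t (.ctr A Γ p) (.ctr A' Γ' p')
  | perm {A B Γ Δ A' B' Γ' Δ'} (p : LK (Γ ++ B :: A :: Δ)) (p' : LK (Γ' ++ B' :: A' :: Δ'))
      (hA : A' = A.subst α t) (hB : B' = B.subst α t)
      (hΓ : Γ' = Γ.map (Formula.subst α t)) (hΔ : Δ' = Δ.map (Formula.subst α t))
      (h : VSub α t p p') : VSub α t (.perm A B Γ Δ p) (.perm A' B' Γ' Δ' p')

/-- `Ren ρ π π'` expresses that `π'` is the result of renaming all variables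
of `π` (in particular its eigenvariables) along `ρ`. -/
inductive Ren (ρ : ℕ → ℕ) : {Γ Δ : Sequent} → LK Γ → LK Δ → Prop
  | ax (b P ts) : Ren ρ (.ax b P ts) (.ax b P (ts.map (Term.ren ρ)))
  | orI {A B Γ A' B' Γ'} (p : LK (A :: B :: Γ)) (p' : LK (A' :: B' :: Γ'))
      (hA : A' = A.ren ρ) (hB : B' = B.ren ρ) (hΓ : Γ' = Γ.map (Formula.ren ρ))
      (h : Ren ρ p p') : Ren ρ (.orI A B Γ p) (.orI A' B' Γ' p')
  | andI {A B Γ Δ A' B' Γ' Δ'} (p : LK (A :: Γ)) (q : LK (B :: Δ))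
      (p' : LK (A' :: Γ')) (q' : LK (B' :: Δ'))
      (hA : A' = A.ren ρ) (hB : B' = B.ren ρ)
      (hΓ : Γ' = Γ.map (Formula.ren ρ)) (hΔ : Δ' = Δ.map (Formula.ren ρ))
      (hp : Ren ρ p p') (hq : Ren ρ q q') :
      Ren ρ (.andI A B Γ Δ p q) (.andI A' B' Γ' Δ' p' q')
  | allI {v β A Γ v' β' A' Γ'} (p : LK (A.subst v (.var β) :: Γ))
      (p' : LK (A'.subst v' (.var β') :: Γ'))
      (hv : v' = ρ v) (hβ : β' = ρ β) (hA : A' = A.ren ρ)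
      (hΓ : Γ' = Γ.map (Formula.ren ρ)) (h : Ren ρ p p') :
      Ren ρ (.allI v β A Γ p) (.allI v' β' A' Γ' p')
  | exI {v r A Γ v' A' Γ'} (p : LK (A.subst v r :: Γ))
      (p' : LK (A'.subst v' (r.ren ρ) :: Γ'))
      (hv : v' = ρ v) (hA : A' = A.ren ρ) (hΓ : Γ' = Γ.map (Formula.ren ρ))
      (h : Ren ρ p p') : Ren ρ (.exI v r A Γ p) (.exI v' (r.ren ρ) A' Γ' p')
  | cut {A Γ Δ A' Γ' Δ'} (p : LK (A :: Γ)) (q : LK (A.dual :: Δ))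
      (p' : LK (A' :: Γ')) (q' : LK (A'.dual :: Δ'))
      (hA : A' = A.ren ρ) (hΓ : Γ' = Γ.map (Formula.ren ρ)) (hΔ : Δ' = Δ.map (Formula.ren ρ))
      (hp : Ren ρ p p') (hq : Ren ρ q q') :
      Ren ρ (.cut A Γ Δ p q) (.cut A' Γ' Δ' p' q')
  | wk {A Γ A' Γ'} (p : LK Γ) (p' : LK Γ')
      (hA : A' = A.ren ρ) (hΓ : Γ' = Γ.map (Formula.ren ρ)) (h : Ren ρ p p') :
      Ren ρ (.wk A Γ p) (.wk A' Γ' p')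
  | ctr {A Γ A' Γ'} (p : LK (A :: A :: Γ)) (p' : LK (A' :: A' :: Γ'))
      (hA : A' = A.ren ρ) (hΓ : Γ' = Γ.map (Formula.ren ρ)) (h : Ren ρ p p') :
      Ren ρ (.ctr A Γ p) (.ctr A' Γ' p')
  | perm {A B Γ Δ A' B' Γ' Δ'} (p : LK (Γ ++ B :: A :: Δ)) (p' : LK (Γ' ++ B' :: A' :: Δ'))
      (hA : A' = A.ren ρ) (hB : B' = B.ren ρ)
      (hΓ : Γ' = Γ.map (Formula.ren ρ)) (hΔ : Δ' = Δ.map (Formula.ren ρ))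
      (h : Ren ρ p p') : Ren ρ (.perm A B Γ Δ p) (.perm A' B' Γ' Δ' p')

/-- `π'` is a fresh (eigenvariable-renamed) copy of `π` with the same end
sequent. -/
def FreshCopy (p q : PProof) : Prop := p.1 = q.1 ∧ ∃ ρ : ℕ → ℕ, Ren ρ p.2 q.2

end PGram
namespace PGram

/-! ### Gentzen-style cut reduction steps (Figure 1) -/

/-- Axiom reduction, redex: a cut of `π₀ ⊢ Γ, A` against the axiom `Ā, A`. -/
def axRedex {b : Bool} {P : ℕ} {ts : List Term} {Γ : Sequent}
    (π₀ : LK (Γ ++ [Formula.atom b P ts])) : PProof :=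
  ⟨Γ ++ [Formula.atom b P ts],
    .cut (.atom b P ts) Γ [.atom b P ts] (LK.toFront _ Γ π₀)
      (LK.castSeq (by simp [Formula.dual]) (.ax (!b) P ts))⟩

/-- Boolean reduction, redex. -/
def boolRedex {A B : Formula} {Γ Δ Λ : Sequent} (π₀ : LK (A :: Γ)) (π₁ : LK (B :: Δ))
    (π₂ : LK (A.dual :: B.dual :: Λ)) : PProof :=
  ⟨(Γ ++ Δ) ++ Λ,
    .cut (.and A B) (Γ ++ Δ) Λ (.andI A B Γ Δ π₀ π₁) (.orI A.dual B.dual Λ π₂)⟩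

/-- Boolean reduction, reduct. -/
def boolReduct {A B : Formula} {Γ Δ Λ : Sequent} (π₀ : LK (A :: Γ)) (π₁ : LK (B :: Δ))
    (π₂ : LK (A.dual :: B.dual :: Λ)) : PProof :=
  ⟨(Γ ++ Δ) ++ Λ,
    LK.castSeq (by simp)
      (.cut A Γ (Δ ++ Λ) π₀
        (LK.pull A.dual Δ (.cut B Δ (A.dual :: Λ) π₁ (.perm B.dual A.dual [] Λ π₂))))⟩

/-- Quantifier reduction, redex: a cut on `∀v A` between a `∀`-inference with
eigenvariable `α` and an `∃`-inference with witness `t`. -/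
def quantRedex {v α : ℕ} {A : Formula} {Γ Δ : Sequent} {t : Term}
    (π₀ : LK (A.subst v (.var α) :: Γ)) (π₁ : LK (A.dual.subst v t :: Δ)) : PProof :=
  ⟨Γ ++ Δ, .cut (.all v A) Γ Δ (.allI v α A Γ π₀) (.exI v t A.dual Δ π₁)⟩

/-- Quantifier reduction, reduct: the cut on `A(v/t)`. -/
def quantReduct {B : Formula} {Γ Δ : Sequent} (π₀' : LK (B :: Γ))
    (π₁' : LK (B.dual :: Δ)) : PProof :=
  ⟨Γ ++ Δ, .cut B Γ Δ π₀' π₁'⟩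

/-- Weakening reduction, redex. -/
def wkRedex {A : Formula} {Γ Δ : Sequent} (π₀ : LK Γ) (π₁ : LK (A.dual :: Δ)) : PProof :=
  ⟨Γ ++ Δ, .cut A Γ Δ (.wk A Γ π₀) π₁⟩

/-- Weakening reduction, reduct: `π₀` followed by weakenings introducing `Δ`. -/
def wkReduct {Γ : Sequent} (Δ : Sequent) (π₀ : LK Γ) : PProof :=
  ⟨Γ ++ Δ, LK.wkEnd Δ π₀⟩

/-- Contraction reduction, redex: a cut on `F` against a contraction on `F`. -/
def ctrRedex {F : Formula} {Γ Δ : Sequent} (π₀ : LK (F :: F :: Γ))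
    (π₁ : LK (F.dual :: Δ)) : PProof :=
  ⟨Γ ++ Δ, .cut F Γ Δ (.ctr F Γ π₀) π₁⟩

/-- Contraction reduction, reduct: two successive cuts (against `π₁` and a
fresh copy `π₁'` of it) followed by contractions `c*` of the duplicated
context `Δ`. -/
def ctrReduct {F : Formula} {Γ Δ : Sequent} (π₀ : LK (F :: F :: Γ))
    (π₁ π₁' : LK (F.dual :: Δ)) : PProof :=
  ⟨Γ ++ Δ,
    LK.ctrBlock Δ Γ
      (LK.castSeq (by simp) (.cut F (Γ ++ Δ) Δ (.cut F (F :: Γ) Δ π₀ π₁) π₁'))⟩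

/-- Permutation of two cuts (on `F` and on `G`), the un-permuted proof. -/
def cutPerm1 {F G : Formula} {Γ Δ Λ : Sequent} (π₀ : LK (F :: G :: Γ))
    (π₁ : LK (F.dual :: Δ)) (π₂ : LK (G.dual :: Λ)) : PProof :=
  ⟨(Γ ++ Δ) ++ Λ, .cut G (Γ ++ Δ) Λ (.cut F (G :: Γ) Δ π₀ π₁) π₂⟩

/-- Permutation of two cuts (on `F` and on `G`), the permuted proof. -/
def cutPerm2 {F G : Formula} {Γ Δ Λ : Sequent} (π₀ : LK (F :: G :: Γ))
    (π₁ : LK (F.dual :: Δ)) (π₂ : LK (G.dual :: Λ)) : PProof :=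
  ⟨(Γ ++ Δ) ++ Λ,
    LK.castSeq (by simp)
      (LK.swapBlk Δ Γ Λ
        (LK.castSeq (by simp)
          (.cut F (Γ ++ Λ) Δ (.cut G (F :: Γ) Λ (.perm G F [] Γ π₀) π₂) π₁)))⟩

/-- Root axiom reduction step. -/
inductive RAx : PProof → PProof → Prop
  | mk {b : Bool} {P : ℕ} {ts : List Term} {Γ : Sequent}
      (π₀ : LK (Γ ++ [Formula.atom b P ts])) : RAx (axRedex π₀) ⟨_, π₀⟩

/-- Root boolean reduction step. -/
inductive RBool : PProof → PProof → Prop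
  | mk {A B : Formula} {Γ Δ Λ : Sequent} (π₀ : LK (A :: Γ)) (π₁ : LK (B :: Δ))
      (π₂ : LK (A.dual :: B.dual :: Λ)) :
      RBool (boolRedex π₀ π₁ π₂) (boolReduct π₀ π₁ π₂)

/-- Root quantifier reduction step. -/
inductive RQuant : PProof → PProof → Prop
  | mk {v α : ℕ} {A B : Formula} {Γ Δ : Sequent} {t : Term}
      (π₀ : LK (A.subst v (.var α) :: Γ)) (π₁ : LK (A.dual.subst v t :: Δ))
      (π₀' : LK (B :: Γ)) (π₁' : LK (B.dual :: Δ)) (hB : B = A.subst v t)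
      (hs : VSub α t π₀ π₀') (hπ : HEq π₁ π₁') :
      RQuant (quantRedex π₀ π₁) (quantReduct π₀' π₁')

/-- Root weakening reduction step. -/
inductive RWk : PProof → PProof → Prop
  | mk {A : Formula} {Γ Δ : Sequent} (π₀ : LK Γ) (π₁ : LK (A.dual :: Δ)) :
      RWk (wkRedex (A := A) π₀ π₁) (wkReduct Δ π₀)

/-- Root contraction reduction step on the cut formula `F`. -/
inductive RCtr (F : Formula) : PProof → PProof → Prop
  | mk {Γ Δ : Sequent} (π₀ : LK (F :: F :: Γ)) (π₁ π₁' : LK (F.dual :: Δ))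
      (hfresh : FreshCopy ⟨_, π₁⟩ ⟨_, π₁'⟩) :
      RCtr F (ctrRedex π₀ π₁) (ctrReduct π₀ π₁ π₁')

/-- Root permutation of a unary inference below a cut. -/
inductive RUn : PProof → PProof → Prop
  | orP {A B F : Formula} {Ξ₁ Ξ₂ Δ : Sequent} (π₀ : LK (A :: B :: (Ξ₁ ++ F :: Ξ₂)))
      (π₁ : LK (F.dual :: Δ)) :
      RUn ⟨_, .cut F (.or A B :: (Ξ₁ ++ Ξ₂)) Δ
              (LK.pull F (.or A B :: Ξ₁) (.orI A B (Ξ₁ ++ F :: Ξ₂) π₀)) π₁⟩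
          ⟨_, .orI A B ((Ξ₁ ++ Ξ₂) ++ Δ)
              (.cut F (A :: B :: (Ξ₁ ++ Ξ₂)) Δ (LK.pull F (A :: B :: Ξ₁) π₀) π₁)⟩
  | allP {v β : ℕ} {A F : Formula} {Ξ₁ Ξ₂ Δ : Sequent}
      (π₀ : LK (A.subst v (.var β) :: (Ξ₁ ++ F :: Ξ₂))) (π₁ : LK (F.dual :: Δ)) :
      RUn ⟨_, .cut F (.all v A :: (Ξ₁ ++ Ξ₂)) Δ
              (LK.pull F (.all v A :: Ξ₁) (.allI v β A (Ξ₁ ++ F :: Ξ₂) π₀)) π₁⟩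
          ⟨_, .allI v β A ((Ξ₁ ++ Ξ₂) ++ Δ)
              (.cut F (A.subst v (.var β) :: (Ξ₁ ++ Ξ₂)) Δ
                (LK.pull F (A.subst v (.var β) :: Ξ₁) π₀) π₁)⟩
  | exP {v : ℕ} {t : Term} {A F : Formula} {Ξ₁ Ξ₂ Δ : Sequent}
      (π₀ : LK (A.subst v t :: (Ξ₁ ++ F :: Ξ₂))) (π₁ : LK (F.dual :: Δ)) :
      RUn ⟨_, .cut F (.ex v A :: (Ξ₁ ++ Ξ₂)) Δ
              (LK.pull F (.ex v A :: Ξ₁) (.exI v t A (Ξ₁ ++ F :: Ξ₂) π₀)) π₁⟩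
          ⟨_, .exI v t A ((Ξ₁ ++ Ξ₂) ++ Δ)
              (.cut F (A.subst v t :: (Ξ₁ ++ Ξ₂)) Δ
                (LK.pull F (A.subst v t :: Ξ₁) π₀) π₁)⟩
  | wkP {B F : Formula} {Ξ₁ Ξ₂ Δ : Sequent} (π₀ : LK (Ξ₁ ++ F :: Ξ₂))
      (π₁ : LK (F.dual :: Δ)) :
      RUn ⟨_, .cut F (B :: (Ξ₁ ++ Ξ₂)) Δ
              (LK.pull F (B :: Ξ₁) (.wk B (Ξ₁ ++ F :: Ξ₂) π₀)) π₁⟩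
          ⟨_, .wk B ((Ξ₁ ++ Ξ₂) ++ Δ)
              (.cut F (Ξ₁ ++ Ξ₂) Δ (LK.pull F Ξ₁ π₀) π₁)⟩
  | ctrP {B F : Formula} {Ξ₁ Ξ₂ Δ : Sequent} (π₀ : LK (B :: B :: (Ξ₁ ++ F :: Ξ₂)))
      (π₁ : LK (F.dual :: Δ)) :
      RUn ⟨_, .cut F (B :: (Ξ₁ ++ Ξ₂)) Δ
              (LK.pull F (B :: Ξ₁) (.ctr B (Ξ₁ ++ F :: Ξ₂) π₀)) π₁⟩
          ⟨_, .ctr B ((Ξ₁ ++ Ξ₂) ++ Δ)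
              (.cut F (B :: B :: (Ξ₁ ++ Ξ₂)) Δ (LK.pull F (B :: B :: Ξ₁) π₀) π₁)⟩
  | permP {C D F : Formula} {Λ Θ Δ : Sequent} (π₀ : LK (F :: (Λ ++ D :: C :: Θ)))
      (π₁ : LK (F.dual :: Δ)) :
      RUn ⟨_, .cut F (Λ ++ C :: D :: Θ) Δ (.perm C D (F :: Λ) Θ π₀) π₁⟩
          ⟨(Λ ++ C :: D :: Θ) ++ Δ, LK.castSeq (by simp)
              (.perm C D Λ (Θ ++ Δ)
                (LK.castSeq (by simp) (.cut F (Λ ++ D :: C :: Θ) Δ π₀ π₁)))⟩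

/-- Root permutation of a binary inference (here `∧`) below a cut, the cut
attaching to the right premise. -/
inductive RBin : PProof → PProof → Prop
  | andR {A B F : Formula} {Γ Ξ₁ Ξ₂ Δ : Sequent} (π₀ : LK (A :: Γ))
      (π₁ : LK (B :: (Ξ₁ ++ F :: Ξ₂))) (π₂ : LK (F.dual :: Δ)) :
      RBin ⟨_, .cut F (.and A B :: ((Γ ++ Ξ₁) ++ Ξ₂)) Δ
              (LK.pull F (.and A B :: (Γ ++ Ξ₁))
                (LK.castSeq (by simp) (.andI A B Γ (Ξ₁ ++ F :: Ξ₂) π₀ π₁))) π₂⟩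
           ⟨(Formula.and A B :: ((Γ ++ Ξ₁) ++ Ξ₂)) ++ Δ, LK.castSeq (by simp)
              (.andI A B Γ ((Ξ₁ ++ Ξ₂) ++ Δ) π₀
                (.cut F (B :: (Ξ₁ ++ Ξ₂)) Δ (LK.pull F (B :: Ξ₁) π₁) π₂))⟩

/-- Root permutation of two cuts, on the cut formulas `F` and `G`. -/
inductive RCut (F G : Formula) : PProof → PProof → Prop
  | mk {Γ Δ Λ : Sequent} (π₀ : LK (F :: G :: Γ)) (π₁ : LK (F.dual :: Δ))
      (π₂ : LK (G.dual :: Λ)) : RCut F G (cutPerm1 π₀ π₁ π₂) (cutPerm2 π₀ π₁ π₂)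

/-- Any root reduction or permutation step of Figure 1. -/
def RedRoot (p q : PProof) : Prop :=
  RAx p q ∨ RBool p q ∨ RQuant p q ∨ RWk p q ∨ (∃ F, RCtr F p q) ∨ RUn p q ∨ RBin p q ∨
    ∃ F G, RCut F G p q

/-- Closure of a root relation under all inference-rule contexts: `Clo R`
applies `R` to an arbitrary sub-proof. -/
inductive Clo (R : PProof → PProof → Prop) : PProof → PProof → Prop
  | base {p q : PProof} : R p q → Clo R p q
  | orC {A B Γ} {p q : LK (A :: B :: Γ)} :
      Clo R ⟨_, p⟩ ⟨_, q⟩ → Clo R ⟨_, LK.orI A B Γ p⟩ ⟨_, LK.orI A B Γ q⟩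
  | andL {A B Γ Δ} {p q : LK (A :: Γ)} (r : LK (B :: Δ)) :
      Clo R ⟨_, p⟩ ⟨_, q⟩ → Clo R ⟨_, LK.andI A B Γ Δ p r⟩ ⟨_, LK.andI A B Γ Δ q r⟩
  | andR {A B Γ Δ} (r : LK (A :: Γ)) {p q : LK (B :: Δ)} :
      Clo R ⟨_, p⟩ ⟨_, q⟩ → Clo R ⟨_, LK.andI A B Γ Δ r p⟩ ⟨_, LK.andI A B Γ Δ r q⟩
  | allC {v α A Γ} {p q : LK (A.subst v (.var α) :: Γ)} :
      Clo R ⟨_, p⟩ ⟨_, q⟩ → Clo R ⟨_, LK.allI v α A Γ p⟩ ⟨_, LK.allI v α A Γ q⟩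
  | exC {v t A Γ} {p q : LK (A.subst v t :: Γ)} :
      Clo R ⟨_, p⟩ ⟨_, q⟩ → Clo R ⟨_, LK.exI v t A Γ p⟩ ⟨_, LK.exI v t A Γ q⟩
  | cutL {A Γ Δ} {p q : LK (A :: Γ)} (r : LK (A.dual :: Δ)) :
      Clo R ⟨_, p⟩ ⟨_, q⟩ → Clo R ⟨_, LK.cut A Γ Δ p r⟩ ⟨_, LK.cut A Γ Δ q r⟩
  | cutR {A Γ Δ} (r : LK (A :: Γ)) {p q : LK (A.dual :: Δ)} :
      Clo R ⟨_, p⟩ ⟨_, q⟩ → Clo R ⟨_, LK.cut A Γ Δ r p⟩ ⟨_, LK.cut A Γ Δ r q⟩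
  | wkC {A Γ} {p q : LK Γ} :
      Clo R ⟨_, p⟩ ⟨_, q⟩ → Clo R ⟨_, LK.wk A Γ p⟩ ⟨_, LK.wk A Γ q⟩
  | ctrC {A Γ} {p q : LK (A :: A :: Γ)} :
      Clo R ⟨_, p⟩ ⟨_, q⟩ → Clo R ⟨_, LK.ctr A Γ p⟩ ⟨_, LK.ctr A Γ q⟩
  | permC {A B Γ Δ} {p q : LK (Γ ++ B :: A :: Δ)} :
      Clo R ⟨_, p⟩ ⟨_, q⟩ → Clo R ⟨_, LK.perm A B Γ Δ p⟩ ⟨_, LK.perm A B Γ Δ q⟩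

/-- The one-step Gentzen cut-reduction relation (Figure 1), applied to an
arbitrary sub-proof. -/
def Red : PProof → PProof → Prop := Clo RedRoot

/-- Root reduction steps other than contraction reduction and cut-cut
permutation. -/
def OtherRoot (p r : PProof) : Prop :=
  RAx p r ∨ RBool p r ∨ RQuant p r ∨ RWk p r ∨ RUn p r ∨ RBin p r

/-- Root steps of the strategy of Theorem 1(1)-(2): a contraction on a
universally quantified Π₂ cut formula is reduced only when no other reduction
rule is applicable to this cut, and two cuts are permuted only when not both
cut formulas are Π₂. -/
def Strat1Root (p q : PProof) : Prop :=
  OtherRoot p q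
    ∨ (∃ F, RCtr F p q ∧ (UnivPi2 F → ∀ r, ¬ (OtherRoot p r ∨ ∃ F' G', RCut F' G' p r)))
    ∨ (∃ F G, RCut F G p q ∧ ¬ (Pi2 F ∧ Pi2 G))

/-- Root steps of the weak-side-first strategy: a step acting on the strong
(universal) side of a cut on a genuine Π₂ cut formula — a contraction
reduction, or a permutation of two Π₂ cuts — is taken only when no reduction
acting on the weak side is applicable to this cut. -/
def WeakFirstRoot (p q : PProof) : Prop :=
  OtherRoot p q
    ∨ (∃ F, RCtr F p q ∧ (UnivPi2 F → ∀ r, ¬ OtherRoot p r))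
    ∨ (∃ F G, RCut F G p q ∧ ((Pi2 F ∧ Pi2 G) → ∀ r, ¬ OtherRoot p r))

/-! ### Sub-proofs, non-terminal occurrences, types -/

/-- Immediate sub-proof. -/
inductive ImSub : PProof → PProof → Prop
  | orI {A B Γ} (p : LK (A :: B :: Γ)) : ImSub ⟨_, p⟩ ⟨_, LK.orI A B Γ p⟩
  | andL {A B Γ Δ} (p : LK (A :: Γ)) (q : LK (B :: Δ)) : ImSub ⟨_, p⟩ ⟨_, LK.andI A B Γ Δ p q⟩
  | andR {A B Γ Δ} (p : LK (A :: Γ)) (q : LK (B :: Δ)) : ImSub ⟨_, q⟩ ⟨_, LK.andI A B Γ Δ p q⟩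
  | allI {v α A Γ} (p : LK (A.subst v (.var α) :: Γ)) : ImSub ⟨_, p⟩ ⟨_, LK.allI v α A Γ p⟩
  | exI {v t A Γ} (p : LK (A.subst v t :: Γ)) : ImSub ⟨_, p⟩ ⟨_, LK.exI v t A Γ p⟩
  | cutL {A Γ Δ} (p : LK (A :: Γ)) (q : LK (A.dual :: Δ)) : ImSub ⟨_, p⟩ ⟨_, LK.cut A Γ Δ p q⟩
  | cutR {A Γ Δ} (p : LK (A :: Γ)) (q : LK (A.dual :: Δ)) : ImSub ⟨_, q⟩ ⟨_, LK.cut A Γ Δ p q⟩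
  | wk {A Γ} (p : LK Γ) : ImSub ⟨_, p⟩ ⟨_, LK.wk A Γ p⟩
  | ctr {A Γ} (p : LK (A :: A :: Γ)) : ImSub ⟨_, p⟩ ⟨_, LK.ctr A Γ p⟩
  | perm {A B Γ Δ} (p : LK (Γ ++ B :: A :: Δ)) : ImSub ⟨_, p⟩ ⟨_, LK.perm A B Γ Δ p⟩

/-- Strict sub-proof. -/
def StrictSub : PProof → PProof → Prop := Relation.TransGen ImSub

/-- The proofs indexing the non-terminals occurring in a grammar term. -/
def GTerm.nts : GTerm → List PProof
  | .bvar _ => []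
  | .fvar _ => []
  | .fn _ => []
  | .unit => []
  | .app s t => s.nts ++ t.nts
  | .lam s => s.nts
  | .pair s t => s.nts ++ t.nts
  | .esub s _ t => s.nts ++ t.nts
  | .nt p _ => [p]
  | .pr0 s => s.nts
  | .pr1 s => s.nts

/-- Types of the proof grammar: ground types `o` (structured first-order
terms) and `ε` (unit), pair types and function types. -/
inductive GType : Type
  | o
  | eps
  | prod (ρ σ : GType)
  | arr (ρ σ : GType)

/-- The order of a type. -/
def GType.ord : GType → ℕ
  | .o => 0
  | .eps => 0
  | .prod ρ σ => max ρ.ord σ.ord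
  | .arr ρ σ => max (ρ.ord + 1) σ.ord

/-- `o^n`. -/
def GType.opow : ℕ → GType
  | 0 => .eps
  | n + 1 => .prod .o (GType.opow n)

/-- `o → ⋯ → o → τ` with `m` arguments. -/
def GType.arrows : ℕ → GType → GType
  | 0, τ => τ
  | m + 1, τ => .arr .o (GType.arrows m τ)

/-- The output type `τ_F` of a prenex formula `F`. -/
def tauF (F : Formula) : GType := .opow F.prefEx

/-- The argument type `τ*_F` of a prenex formula `F`. -/
def taustarF (F : Formula) : GType :=
  if F.headEx = true ∧ 0 < F.prefAll then .arrows F.prefEx (.opow F.prefAll)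
  else .opow F.prefAll

/-- The type `τ*_{A₀} → ⋯ → τ*_{Aₙ} → τ_{Aᵢ}` of the non-terminal `σ_π^i`
for `π ⊢ Γ = A₀,…,Aₙ`. -/
def ntType (Γ : Sequent) (i : ℕ) : GType :=
  (Γ.map taustarF).foldr .arr (tauF (Γ.getD i default))

end PGram

namespace PGram

/-! ### Spines of applications -/

theorem apps_concat (h : GTerm) (l : List GTerm) (z : GTerm) :
    GTerm.apps h (l ++ [z]) = .app (GTerm.apps h l) z := by
  simp [GTerm.apps]

theorem apps_cons (h : GTerm) (z : GTerm) (l : List GTerm) :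
    GTerm.apps h (z :: l) = GTerm.apps (.app h z) l := rfl

/-- The head of the application spine of a term. -/
def GTerm.spineHead : GTerm → GTerm
  | .app s _ => s.spineHead
  | t => t

/-- The arguments of the application spine of a term, followed by `acc`. -/
def GTerm.spineArgs : GTerm → List GTerm → List GTerm
  | .app s t, acc => s.spineArgs (t :: acc)
  | _, acc => acc

theorem spineHead_apps (h : GTerm) (l : List GTerm) :
    (GTerm.apps h l).spineHead = h.spineHead := by
  induction l generalizing h with
  | nil => rfl
  | cons z l ih => rw [apps_cons, ih]; rfl

theorem spineArgs_apps (h : GTerm) (l acc : List GTerm) :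
    (GTerm.apps h l).spineArgs acc = h.spineArgs (l ++ acc) := by
  induction l generalizing h with
  | nil => rfl
  | cons z l ih => rw [apps_cons, ih]; rfl

theorem apps_nt_inj {p q : PProof} {i j : ℕ} {zs ws : List GTerm}
    (h : GTerm.apps (.nt p i) zs = GTerm.apps (.nt q j) ws) : p = q ∧ i = j ∧ zs = ws := by
  have h1 := congrArg GTerm.spineHead h
  have h2 := congrArg (fun t => GTerm.spineArgs t []) h
  simp only [spineHead_apps, spineArgs_apps] at h1 h2
  simp only [GTerm.spineHead, GTerm.spineArgs, GTerm.nt.injEq, List.append_nil] at h1 h2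
  exact ⟨h1.1, h1.2, h2⟩

/-- `neut n t`: the term `t`, when applied to `n` arguments, is not a value, and applying it to
further arguments creates no new redex. -/
def GTerm.neut : ℕ → GTerm → Prop
  | n, .app s _ => GTerm.neut (n + 1) s
  | n, .lam _ => 1 ≤ n
  | n, .unit => 1 ≤ n
  | n, .pair _ _ => 1 ≤ n
  | n, .nt p _ => p.1.length ≤ n
  | _, _ => True

theorem neut_mono {m n : ℕ} (hmn : m ≤ n) {t : GTerm} (h : t.neut m) : t.neut n := by
  induction t generalizing m n with
  | app s t ih _ => exact ih (Nat.succ_le_succ hmn) h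
  | _ => simp only [GTerm.neut] at h ⊢ <;> omega

theorem neut_app {t : GTerm} (h : t.neut 0) (u : GTerm) : (GTerm.app t u).neut 0 :=
  neut_mono (Nat.zero_le 1) h

theorem neut_apps (n : ℕ) (h : GTerm) (l : List GTerm) :
    (GTerm.apps h l).neut n ↔ h.neut (n + l.length) := by
  induction l generalizing h n with
  | nil => rfl
  | cons z l ih =>
    rw [apps_cons, ih]
    simp only [GTerm.neut, List.length_cons]
    rfl

/-! ### Inversion of the rewriting relation -/

/-- The possible right-hand sides of the production rules for `σ_π^i` applied to `zs`. -/
def prods : {Γ : Sequent} → LK Γ → ℕ → List GTerm → List GTerm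
  | _, .ax .., i, zs => if i = 0 then [zs.tail.headD .unit] else [zs.headD .unit]
  | _, .orI _ _ _ p, i, zs =>
      if i = 0 then [.unit] else [GTerm.apps (.nt ⟨_, p⟩ (i + 1)) (.unit :: .unit :: zs.tail)]
  | _, .andI _ _ Γ _ p q, i, zs =>
      if i = 0 then [.unit]
      else if i ≤ Γ.length then
        [GTerm.apps (.nt ⟨_, p⟩ i) (.unit :: zs.tail.take Γ.length)]
      else [GTerm.apps (.nt ⟨_, q⟩ (i - Γ.length)) (.unit :: zs.tail.drop Γ.length)]
  | _, .allI _ α _ _ p, i, zs =>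
      match zs with
      | .pair z₀ z₁ :: ys => [.esub (GTerm.apps (.nt ⟨_, p⟩ i) (z₁ :: ys)) α z₀]
      | _ => []
  | _, .exI _ t _ _ p, i, zs =>
      if i = 0 then
        [.pair t.toG (GTerm.apps (.nt ⟨_, p⟩ 0) (.app (zs.headD .unit) t.toG :: zs.tail))]
      else [GTerm.apps (.nt ⟨_, p⟩ i) (.app (zs.headD .unit) t.toG :: zs.tail)]
  | _, .cut A Γ _ p q, i, zs =>
      if i < Γ.length then
        [GTerm.apps (.nt ⟨_, p⟩ (i + 1))
          (comp A.dual ⟨_, q⟩ ⟨_, p⟩ (zs.drop Γ.length) (zs.take Γ.length) ::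
            zs.take Γ.length)]
      else
        [GTerm.apps (.nt ⟨_, q⟩ (i - Γ.length + 1))
          (comp A ⟨_, p⟩ ⟨_, q⟩ (zs.take Γ.length) (zs.drop Γ.length) :: zs.drop Γ.length)]
  | _, .wk A _ p, i, zs =>
      if i = 0 then [GTerm.constSeq A.prefEx] else [GTerm.apps (.nt ⟨_, p⟩ (i - 1)) zs.tail]
  | _, .ctr _ _ p, i, zs =>
      (if i = 0 then
        [GTerm.apps (.nt ⟨_, p⟩ 0) (zs.headD .unit :: zs.headD .unit :: zs.tail)] else []) ++
      [GTerm.apps (.nt ⟨_, p⟩ (i + 1)) (zs.headD .unit :: zs.headD .unit :: zs.tail)]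
  | _, .perm _ _ Γ _ p, i, zs =>
      [GTerm.apps
        (.nt ⟨_, p⟩ (if i = Γ.length then i + 1 else if i = Γ.length + 1 then i - 1 else i))
        (zs.take Γ.length ++ (zs.drop Γ.length).tail.headD .unit ::
          (zs.drop Γ.length).headD .unit :: (zs.drop Γ.length).tail.tail)]

/-- The rewriting steps other than an application of a production rule at the root. -/
inductive InnerStep : GTerm → GTerm → Prop
  | beta (s t : GTerm) : InnerStep (.app (.lam s) t) (GTerm.instB t 0 s)
  | unitApp (t : GTerm) : InnerStep (.app .unit t) .unit
  | proj0 (s t : GTerm) : InnerStep (.pr0 (.pair s t)) s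
  | proj1 (s t : GTerm) : InnerStep (.pr1 (.pair s t)) t
  | appL {s s'} (t : GTerm) : Step false s s' → InnerStep (.app s t) (.app s' t)
  | appR (s : GTerm) {t t'} : Step false t t' → InnerStep (.app s t) (.app s t')
  | lamC {s s'} : Step false s s' → InnerStep (.lam s) (.lam s')
  | pairL {s s'} (t : GTerm) : Step false s s' → InnerStep (.pair s t) (.pair s' t)
  | pairR (s : GTerm) {t t'} : Step false t t' → InnerStep (.pair s t) (.pair s t')
  | esubL {s s'} (α : ℕ) (t : GTerm) : Step false s s' → InnerStep (.esub s α t) (.esub s' α t)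
  | esubR (s : GTerm) (α : ℕ) {t t'} : Step false t t' → InnerStep (.esub s α t) (.esub s α t')
  | pr0C {s s'} : Step false s s' → InnerStep (.pr0 s) (.pr0 s')
  | pr1C {s s'} : Step false s s' → InnerStep (.pr1 s) (.pr1 s')

/-- An application of a production rule at the root. -/
def RootProd (u v : GTerm) : Prop :=
  ∃ (p : PProof) (i : ℕ) (zs : List GTerm),
    u = GTerm.apps (.nt p i) zs ∧ zs.length = p.1.length ∧ v ∈ prods p.2 i zs

theorem step_cases {u v : GTerm} (h : Step false u v) : RootProd u v ∨ InnerStep u v := by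
  cases h with
  | beta s t => exact .inr (.beta s t)
  | unitApp t => exact .inr (.unitApp t)
  | proj0 => exact .inr (.proj0 _ _)
  | proj1 => exact .inr (.proj1 _ _)
  | appL t h => exact .inr (.appL t h)
  | appR s h => exact .inr (.appR s h)
  | lamC h => exact .inr (.lamC h)
  | pairL t h => exact .inr (.pairL t h)
  | pairR s h => exact .inr (.pairR s h)
  | esubL α t h => exact .inr (.esubL α t h)
  | esubR s α h => exact .inr (.esubR s α h)
  | pr0C h => exact .inr (.pr0C h)
  | pr1C h => exact .inr (.pr1C h)
  | allPcf p i z ys hy hcf => cases hcf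
  | andIL p q i z xs ys hx hy hi =>
    refine .inl ⟨_, _, _, rfl, by simp [*], ?_⟩
    rw [← hx] at hi
    simp [prods, hi, ← hx]
  | andIR p q i z xs ys hx hy hi =>
    refine .inl ⟨_, _, _, rfl, by simp [*], ?_⟩
    rw [← hx] at hi
    simp [prods, Nat.not_lt.2 hi, ← hx, Nat.sub_add_comm hi]
  | permP p i xs z₀ z₁ ys hx hy =>
    refine .inl ⟨_, _, _, rfl, by simp [*], ?_⟩
    simp [prods, ← hx]
  | cutL p q i xs ys hx hy hi =>
    refine .inl ⟨_, _, _, rfl, by simp [*], ?_⟩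
    rw [← hx] at hi
    simp [prods, hi, ← hx]
  | cutR p q i xs ys hx hy hi =>
    refine .inl ⟨_, _, _, rfl, by simp [*], ?_⟩
    rw [← hx] at hi
    simp [prods, Nat.not_lt.2 hi, ← hx]
  | _ => exact .inl ⟨_, _, _, rfl, by simp [*], by simp [prods]⟩

/-- One rewriting step in exactly one component of a list of terms. -/
inductive LStep : List GTerm → List GTerm → Prop
  | head {z z' : GTerm} (ys : List GTerm) : Step false z z' → LStep (z :: ys) (z' :: ys)
  | tail (z : GTerm) {ys ys' : List GTerm} : LStep ys ys' → LStep (z :: ys) (z :: ys')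

theorem step_apps_left {s s' : GTerm} (h : Step false s s') (l : List GTerm) :
    Step false (GTerm.apps s l) (GTerm.apps s' l) := by
  induction l generalizing s s' with
  | nil => exact h
  | cons z l ih => exact ih (.appL z h)

theorem LStep.step_apps {l l' : List GTerm} (h : LStep l l') (s : GTerm) :
    Step false (GTerm.apps s l) (GTerm.apps s l') := by
  induction h generalizing s with
  | head ys h => exact step_apps_left (.appR s h) ys
  | tail z _ ih => exact ih (.app s z)

theorem LStep.append_right {l l' : List GTerm} (h : LStep l l') (m : List GTerm) :
    LStep (l ++ m) (l' ++ m) := by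
  induction h with
  | head ys h => exact .head _ h
  | tail z _ ih => exact .tail z ih

theorem LStep.append_left {m m' : List GTerm} (h : LStep m m') (l : List GTerm) :
    LStep (l ++ m) (l ++ m') := by
  induction l with
  | nil => exact h
  | cons z l ih => exact .tail z ih

theorem step_apps_nt {p : PProof} {i : ℕ} {zs : List GTerm} {v : GTerm}
    (hl : zs.length ≤ p.1.length) (h : Step false (GTerm.apps (.nt p i) zs) v) :
    (zs.length = p.1.length ∧ v ∈ prods p.2 i zs) ∨
      ∃ zs', LStep zs zs' ∧ v = GTerm.apps (.nt p i) zs' := by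
  induction zs using List.reverseRecOn generalizing v with
  | nil =>
    rcases step_cases h with ⟨q, j, ws, he, hlen, hv⟩ | h
    · obtain ⟨rfl, rfl, rfl⟩ := apps_nt_inj he
      exact .inl ⟨hlen, hv⟩
    · cases h
  | append_singleton zs z ih =>
    rcases step_cases h with ⟨q, j, ws, he, hlen, hv⟩ | h
    · obtain ⟨rfl, rfl, rfl⟩ := apps_nt_inj he
      exact .inl ⟨hlen, hv⟩
    · rw [apps_concat] at h
      simp only [List.length_append, List.length_singleton] at hl
      generalize hs : GTerm.apps (.nt p i) zs = s at h
      cases h with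
      | beta s t =>
        have := congrArg GTerm.spineHead hs
        rw [spineHead_apps] at this
        cases this
      | unitApp t =>
        have := congrArg GTerm.spineHead hs
        rw [spineHead_apps] at this
        cases this
      | appL t h =>
        subst hs
        rcases ih (by omega) h with ⟨h1, _⟩ | ⟨zs', h1, rfl⟩
        · omega
        · exact .inr ⟨_, h1.append_right [z], (apps_concat _ _ _).symm⟩
      | appR s h' =>
        subst hs
        exact .inr ⟨zs ++ [_], (LStep.head [] h').append_left zs, (apps_concat _ _ _).symm⟩

theorem step_neut_app {t u v : GTerm} (ht : t.neut 0) (h : Step false (.app t u) v) :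
    (∃ t', Step false t t' ∧ v = .app t' u) ∨ ∃ u', Step false u u' ∧ v = .app t u' := by
  rcases step_cases h with ⟨q, j, ws, he, hlen, hv⟩ | h
  · exfalso
    rcases List.eq_nil_or_concat ws with rfl | ⟨ws, w, rfl⟩
    · cases he
    · rw [List.concat_eq_append, apps_concat] at he
      injection he with h1 h2
      subst h1
      rw [neut_apps] at ht
      simp only [GTerm.neut, List.concat_eq_append, List.length_append,
        List.length_singleton] at ht hlen
      omega
  · cases h with
    | beta s t => simp [GTerm.neut] at ht
    | unitApp t => simp [GTerm.neut] at ht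
    | appL _ h' => exact .inl ⟨_, h', rfl⟩
    | appR _ h' => exact .inr ⟨_, h', rfl⟩

/-- A root production does not apply to a term whose spine head is not a non-terminal. -/
theorem inner_of_step {u v : GTerm} (hu : ∀ p i, u.spineHead ≠ .nt p i)
    (h : Step false u v) : InnerStep u v := by
  rcases step_cases h with ⟨q, j, ws, rfl, _, _⟩ | h
  · exact absurd (spineHead_apps _ _) (hu q j)
  · exact h

/-! ### Finite branching -/

theorem finite_rootProd (u : GTerm) : {v | RootProd u v}.Finite := by
  by_cases h : ∃ p i zs, u = GTerm.apps (.nt p i) zs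
  · obtain ⟨p, i, zs, rfl⟩ := h
    refine (prods p.2 i zs).finite_toSet.subset ?_
    rintro v ⟨q, j, ws, he, _, hv⟩
    obtain ⟨rfl, rfl, rfl⟩ := apps_nt_inj he
    exact hv
  · convert Set.finite_empty
    refine Set.eq_empty_iff_forall_notMem.2 ?_
    rintro v ⟨q, j, ws, he, _⟩
    exact h ⟨q, j, ws, he⟩

theorem finite_step (u : GTerm) : {v | Step false u v}.Finite := by
  have key : {v | InnerStep u v}.Finite → {v | Step false u v}.Finite := fun h =>
    ((finite_rootProd u).union h).subset fun v hv => step_cases hv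
  apply key
  clear key
  induction u with
  | app s t ihs iht =>
    have hs := ((finite_rootProd s).union ihs).image (fun s' => GTerm.app s' t)
    have ht := ((finite_rootProd t).union iht).image (fun t' => GTerm.app s t')
    have hb : {v | ∃ s', s = .lam s' ∧ v = GTerm.instB t 0 s'}.Finite := by
      refine Set.Subsingleton.finite ?_
      rintro _ ⟨a, rfl, rfl⟩ _ ⟨b, hb, rfl⟩
      cases hb
      rfl
    refine (((hs.union ht).union hb).union (Set.finite_singleton .unit)).subset ?_
    intro v hv
    cases hv with
    | beta s t => exact .inl (.inr ⟨_, rfl, rfl⟩)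
    | unitApp t => exact .inr rfl
    | appL t h => exact .inl (.inl (.inl ⟨_, step_cases h, rfl⟩))
    | appR s h => exact .inl (.inl (.inr ⟨_, step_cases h, rfl⟩))
  | lam s ih =>
    refine (((finite_rootProd s).union ih).image GTerm.lam).subset ?_
    intro v hv
    cases hv with
    | lamC h => exact ⟨_, step_cases h, rfl⟩
  | pair s t ihs iht =>
    have hs := ((finite_rootProd s).union ihs).image (fun s' => GTerm.pair s' t)
    have ht := ((finite_rootProd t).union iht).image (fun t' => GTerm.pair s t')
    refine (hs.union ht).subset ?_
    intro v hv
    cases hv with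
    | pairL t h => exact .inl ⟨_, step_cases h, rfl⟩
    | pairR s h => exact .inr ⟨_, step_cases h, rfl⟩
  | esub s α t ihs iht =>
    have hs := ((finite_rootProd s).union ihs).image (fun s' => GTerm.esub s' α t)
    have ht := ((finite_rootProd t).union iht).image (fun t' => GTerm.esub s α t')
    refine (hs.union ht).subset ?_
    intro v hv
    cases hv with
    | esubL α t h => exact .inl ⟨_, step_cases h, rfl⟩
    | esubR s α h => exact .inr ⟨_, step_cases h, rfl⟩
  | pr0 s ih =>
    have hp : {v | ∃ t, s = .pair v t}.Finite := by
      refine Set.Subsingleton.finite ?_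
      rintro _ ⟨a, rfl⟩ _ ⟨b, hb⟩
      cases hb
      rfl
    refine ((((finite_rootProd s).union ih).image GTerm.pr0).union hp).subset ?_
    intro v hv
    cases hv with
    | pr0C h => exact .inl ⟨_, step_cases h, rfl⟩
    | proj0 s t => exact .inr ⟨_, rfl⟩
  | pr1 s ih =>
    have hp : {v | ∃ t, s = .pair t v}.Finite := by
      refine Set.Subsingleton.finite ?_
      rintro _ ⟨a, rfl⟩ _ ⟨b, hb⟩
      cases hb
      rfl
    refine ((((finite_rootProd s).union ih).image GTerm.pr1).union hp).subset ?_
    intro v hv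
    cases hv with
    | pr1C h => exact .inl ⟨_, step_cases h, rfl⟩
    | proj1 s t => exact .inr ⟨_, rfl⟩
  | _ =>
    convert Set.finite_empty
    refine Set.eq_empty_iff_forall_notMem.2 ?_
    rintro v hv
    cases hv

/-! ### Substitution of bound variables -/

theorem shift_shift {d e i j : ℕ} (hj : j ≤ e) (u : GTerm) :
    GTerm.shift d (i + j) (GTerm.shift e i u) = GTerm.shift (d + e) i u := by
  induction u generalizing i with
  | lam s ih =>
    simp only [GTerm.shift]
    rw [← ih, Nat.add_right_comm]
  | bvar n =>
    simp only [GTerm.shift]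
    split_ifs <;> simp only [GTerm.shift] <;> split_ifs <;> simp <;> omega
  | _ => simp only [GTerm.shift, *]

theorem instB_shift_succ {e i j : ℕ} (hj : j ≤ e) (u x : GTerm) :
    GTerm.instB u (i + j) (GTerm.shift (e + 1) i x) = GTerm.shift e i x := by
  induction x generalizing i with
  | lam s ih =>
    simp only [GTerm.shift, GTerm.instB]
    rw [← ih, Nat.add_right_comm]
  | bvar n =>
    simp only [GTerm.shift]
    split_ifs <;> simp only [GTerm.instB] <;> split_ifs <;> first | omega | (simp; try omega)
  | _ => simp only [GTerm.shift, GTerm.instB, *]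

theorem instB_shift {d k j : ℕ} (u x : GTerm) :
    GTerm.instB u (k + d + j) (GTerm.shift d j x) =
      GTerm.shift d j (GTerm.instB u (k + j) x) := by
  induction x generalizing j with
  | lam s ih =>
    simp only [GTerm.shift, GTerm.instB, Nat.add_assoc] at ih ⊢
    rw [ih]
  | bvar n =>
    simp only [GTerm.shift, GTerm.instB]
    rcases lt_trichotomy n (k + j) with h | h | h
    · rw [if_neg (by omega : ¬ n = k + j), if_neg (by omega : ¬ k + j < n)]
      simp only [GTerm.shift]
      split_ifs <;> simp only [GTerm.instB] <;> split_ifs <;> first | rfl | omega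
    · rw [if_pos h, if_neg (by omega : ¬ n < j)]
      simp only [GTerm.instB]
      rw [if_pos (by omega)]
      have := shift_shift (d := d) (i := 0) (Nat.le_add_left j k) u
      rw [Nat.zero_add] at this
      rw [this]
      congr 1
      omega
    · rw [if_neg (by omega : ¬ n = k + j), if_pos h, if_neg (by omega : ¬ n < j)]
      simp only [GTerm.shift, GTerm.instB]
      split_ifs <;> first | omega | (simp; try omega)
  | _ => simp only [GTerm.shift, GTerm.instB, *]

theorem instB_instB {k j : ℕ} (u t s : GTerm) :
    GTerm.instB u (k + j) (GTerm.instB t j s) =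
      GTerm.instB (GTerm.instB u k t) j (GTerm.instB u (k + 1 + j) s) := by
  induction s generalizing j with
  | lam s ih =>
    simp only [GTerm.instB, Nat.add_assoc] at ih ⊢
    rw [ih]
  | bvar n =>
    simp only [GTerm.instB]
    rcases lt_trichotomy n j with h | h | h
    · rw [if_neg (by omega : ¬ n = j), if_neg (by omega : ¬ j < n),
        if_neg (by omega : ¬ n = k + 1 + j), if_neg (by omega : ¬ k + 1 + j < n)]
      simp only [GTerm.instB]
      split_ifs <;> first | rfl | omega
    · rw [if_pos h, if_neg (by omega : ¬ n = k + 1 + j), if_neg (by omega : ¬ k + 1 + j < n)]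
      simp only [GTerm.instB]
      rw [if_pos h]
      exact instB_shift (j := 0) u t
    · rw [if_neg (by omega : ¬ n = j), if_pos h]
      simp only [GTerm.instB]
      by_cases h' : n = k + 1 + j
      · rw [if_pos (by omega), if_pos h', show k + 1 + j = k + j + 1 by omega]
        have := instB_shift_succ (i := 0) (Nat.le_add_left j k) (GTerm.instB u k t) u
        rw [Nat.zero_add] at this
        exact this.symm
      · rw [if_neg (by omega), if_neg h']
        split_ifs <;> simp only [GTerm.instB] <;> split_ifs <;> first | rfl | omega
  | _ => simp only [GTerm.instB, *]

theorem instB_apps (u : GTerm) (k : ℕ) (h : GTerm) (l : List GTerm) :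
    GTerm.instB u k (GTerm.apps h l) = GTerm.apps (GTerm.instB u k h) (l.map (GTerm.instB u k)) := by
  induction l generalizing h with
  | nil => rfl
  | cons z l ih => exact ih _

theorem instB_toG (u : GTerm) (k : ℕ) (t : Term) : GTerm.instB u k t.toG = t.toG := by
  induction t with
  | app s t ihs iht => simp only [Term.toG, GTerm.instB, ihs, iht]
  | _ => rfl

theorem instB_lams (u : GTerm) (k n : ℕ) (b : GTerm) :
    GTerm.instB u k (GTerm.lams n b) = GTerm.lams n (GTerm.instB u (k + n) b) := by
  induction n generalizing k with
  | zero => rfl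
  | succ n ih =>
    simp only [GTerm.lams, GTerm.instB, ih]
    rw [Nat.add_right_comm, Nat.add_assoc]

/-- The sequence-term with the given components. -/
def GTerm.tuple (l : List GTerm) : GTerm := l.foldr .pair .unit

theorem instB_tuple (u : GTerm) (k : ℕ) (l : List GTerm) :
    GTerm.instB u k (GTerm.tuple l) = GTerm.tuple (l.map (GTerm.instB u k)) := by
  induction l with
  | nil => rfl
  | cons z l ih => exact congrArg _ ih

theorem varSeq_eq_tuple (n : ℕ) :
    GTerm.varSeq n = GTerm.tuple ((List.range n).reverse.map .bvar) := by
  rw [GTerm.varSeq, GTerm.tuple, List.foldr_map]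

theorem constSeq_eq_tuple (n : ℕ) :
    GTerm.constSeq n = GTerm.tuple (List.replicate n (.fn 0)) := by
  simp only [GTerm.constSeq, GTerm.tuple]
  rw [← List.length_range (n := n), ← List.map_const', List.foldr_map]
  simp

theorem map_instB_bvars {u : GTerm} {k n : ℕ} (h : n ≤ k) :
    ((List.range n).reverse.map GTerm.bvar).map (GTerm.instB u k) =
      (List.range n).reverse.map GTerm.bvar := by
  rw [List.map_map]
  refine List.map_congr_left fun a ha => ?_
  simp only [List.mem_reverse, List.mem_range] at ha
  simp only [Function.comp, GTerm.instB]
  rw [if_neg (by omega), if_neg (by omega)]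

theorem map_instB_shift (u : GTerm) (k n : ℕ) (l : List GTerm) :
    (l.map (GTerm.shift n 0)).map (GTerm.instB u (k + n)) =
      (l.map (GTerm.instB u k)).map (GTerm.shift n 0) := by
  rw [List.map_map, List.map_map]
  exact List.map_congr_left fun a _ => instB_shift (j := 0) u a

theorem instB_comp (u : GTerm) (k : ℕ) (F : Formula) (p q : PProof) (xs ys : List GTerm) :
    GTerm.instB u k (comp F p q xs ys) =
      comp F p q (xs.map (GTerm.instB u k)) (ys.map (GTerm.instB u k)) := by
  unfold comp
  split_ifs
  · rfl
  · rw [instB_lams, instB_apps, List.map_cons, varSeq_eq_tuple, instB_tuple,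
      map_instB_bvars (Nat.le_add_left _ _), map_instB_shift]
    rfl
  · rw [instB_apps, List.map_cons, instB_lams, instB_apps, List.map_cons, varSeq_eq_tuple,
      instB_tuple, map_instB_bvars (Nat.le_add_left _ _), map_instB_shift]
    rfl

theorem Step.instB {s s' : GTerm} (h : Step false s s') (u : GTerm) (k : ℕ) :
    Step false (GTerm.instB u k s) (GTerm.instB u k s') := by
  induction h generalizing k with
  | beta s t =>
    have := instB_instB (k := k) (j := 0) u t s
    rw [Nat.add_zero] at this
    rw [this]
    exact .beta _ _
  | unitApp t => exact .unitApp _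
  | proj0 s t => exact .proj0 _ _
  | proj1 s t => exact .proj1 _ _
  | appL t _ ih => exact .appL _ (ih k)
  | appR s _ ih => exact .appR _ (ih k)
  | lamC _ ih => exact .lamC (ih (k + 1))
  | pairL t _ ih => exact .pairL _ (ih k)
  | pairR s _ ih => exact .pairR _ (ih k)
  | esubL α t _ ih => exact .esubL _ _ (ih k)
  | esubR s α _ ih => exact .esubR _ _ (ih k)
  | pr0C _ ih => exact .pr0C (ih k)
  | pr1C _ ih => exact .pr1C (ih k)
  | ax0 b P ts z₀ z₁ => exact .ax0 b P ts _ _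
  | ax1 b P ts z₀ z₁ => exact .ax1 b P ts _ _
  | orI0 p z ys hy =>
    simp only [instB_apps]
    exact .orI0 p _ _ (by simpa using hy)
  | orIS p i z ys hy =>
    simp only [instB_apps]
    exact .orIS p i _ _ (by simpa using hy)
  | andI0 p q z xs ys hx hy =>
    simp only [instB_apps, List.map_cons, List.map_append]
    exact .andI0 p q _ _ _ (by simpa using hx) (by simpa using hy)
  | andIL p q i z xs ys hx hy hi =>
    simp only [instB_apps, List.map_cons, List.map_append]
    exact .andIL p q i _ _ _ (by simpa using hx) (by simpa using hy) hi
  | andIR p q i z xs ys hx hy hi =>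
    simp only [instB_apps, List.map_cons, List.map_append]
    exact .andIR p q i _ _ _ (by simpa using hx) (by simpa using hy) hi
  | allP p i z₀ z₁ ys hy hcf =>
    simp only [instB_apps, GTerm.instB]
    exact .allP p i _ _ _ (by simpa using hy) hcf
  | allPcf p i z ys hy hcf => cases hcf
  | exI0 p z ys hy =>
    simp only [instB_apps, List.map_cons, GTerm.instB, instB_toG]
    exact .exI0 p _ _ (by simpa using hy)
  | exIS p i z ys hy =>
    simp only [instB_apps, List.map_cons, GTerm.instB, instB_toG]
    exact .exIS p i _ _ (by simpa using hy)
  | cutL p q i xs ys hx hy hi =>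
    rw [instB_apps, instB_apps, List.map_cons, List.map_append,
      instB_comp u k _ ⟨_, q⟩ ⟨_, p⟩]
    exact .cutL p q i _ _ (by simpa using hx) (by simpa using hy) hi
  | cutR p q i xs ys hx hy hi =>
    rw [instB_apps, instB_apps, List.map_cons, List.map_append,
      instB_comp u k _ ⟨_, p⟩ ⟨_, q⟩]
    exact .cutR p q i _ _ (by simpa using hx) (by simpa using hy) hi
  | ctr0a p z ys hy =>
    simp only [instB_apps]
    exact .ctr0a p _ _ (by simpa using hy)
  | ctr0b p z ys hy =>
    simp only [instB_apps]
    exact .ctr0b p _ _ (by simpa using hy)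
  | ctrS p i z ys hy =>
    simp only [instB_apps]
    exact .ctrS p i _ _ (by simpa using hy)
  | wk0 p z ys hy =>
    rw [instB_apps, constSeq_eq_tuple, instB_tuple, List.map_replicate]
    simp only [GTerm.instB]
    rw [← constSeq_eq_tuple]
    exact .wk0 p _ _ (by simpa using hy)
  | wkS p i z ys hy =>
    simp only [instB_apps]
    exact .wkS p i _ _ (by simpa using hy)
  | permP p i xs z₀ z₁ ys hx hy =>
    simp only [instB_apps, List.map_cons, List.map_append]
    exact .permP p i _ _ _ _ (by simpa using hx) (by simpa using hy)

/-! ### Reducibility candidates -/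

/-- Strong normalization. -/
abbrev Sn (t : GTerm) : Prop := Acc (fun b a => Step false a b) t

/-- Reducibility candidates. -/
structure Cand (X : Set GTerm) : Prop where
  sn : ∀ {t}, t ∈ X → Sn t
  step : ∀ {t t'}, t ∈ X → Step false t t' → t' ∈ X
  of_neut : ∀ {t}, t.neut 0 → (∀ t', Step false t t' → t' ∈ X) → t ∈ X
  unit : GTerm.unit ∈ X

theorem sn_unit : Sn .unit :=
  ⟨_, fun _ h => by
    cases inner_of_step (by simp [GTerm.spineHead]) h⟩

/-- The candidate of sequence-terms with tail in `X`. -/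
def pairC (X : Set GTerm) : Set GTerm :=
  {t | Sn t ∧ ∀ a b, Relation.ReflTransGen (Step false) t (.pair a b) → b ∈ X}

/-- The candidate of functions from strongly normalizing terms to `X`. -/
def arrC (X : Set GTerm) : Set GTerm := {t | ∀ u, Sn u → .app t u ∈ X}

theorem cand_sn : Cand {t | Sn t} where
  sn h := h
  step h h' := h.inv h'
  of_neut _ h := ⟨_, h⟩
  unit := sn_unit

theorem sn_of_sn_app {t u : GTerm} (h : Sn (.app t u)) : Sn t := by
  generalize hs : GTerm.app t u = s at h
  induction h generalizing t with
  | intro s _ ih =>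
    subst hs
    exact ⟨_, fun t' ht => ih _ (.appL u ht) rfl⟩

theorem cand_arrC {X : Set GTerm} (hX : Cand X) : Cand (arrC X) where
  sn h := sn_of_sn_app (hX.sn (h _ sn_unit))
  step h h' u hu := hX.step (h u hu) (.appL u h')
  of_neut {t} ht h u hu := by
    induction hu with
    | intro u hu ih =>
      refine hX.of_neut (neut_app ht u) fun v hv => ?_
      rcases step_neut_app ht hv with ⟨t', h', rfl⟩ | ⟨u', h', rfl⟩
      · exact h t' h' u ⟨_, hu⟩
      · exact ih u' h'
  unit u hu := by
    induction hu with
    | intro u hu ih =>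
      refine hX.of_neut (by simp [GTerm.neut]) fun v hv => ?_
      cases inner_of_step (by simp [GTerm.spineHead]) hv with
      | unitApp => exact hX.unit
      | appL t h => cases inner_of_step (by simp [GTerm.spineHead]) h
      | appR s h => exact ih _ h

theorem cand_pairC (X : Set GTerm) : Cand (pairC X) where
  sn h := h.1
  step h h' := ⟨h.1.inv h', fun a b hab => h.2 a b (.head h' hab)⟩
  of_neut {t} ht h := by
    refine ⟨⟨_, fun t' h' => (h t' h').1⟩, fun a b hab => ?_⟩
    rcases hab.cases_head with rfl | ⟨t', h', hab⟩
    · simp [GTerm.neut] at ht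
    · exact (h t' h').2 a b hab
  unit := by
    refine ⟨sn_unit, fun a b hab => ?_⟩
    rcases hab.cases_head with h | ⟨t', h', hab⟩
    · cases h
    · cases inner_of_step (by simp [GTerm.spineHead]) h'

theorem cand_iterate {f : Set GTerm → Set GTerm} (hf : ∀ X, Cand X → Cand (f X))
    {X : Set GTerm} (hX : Cand X) (n : ℕ) : Cand (f^[n] X) := by
  induction n with
  | zero => exact hX
  | succ n ih =>
    rw [Function.iterate_succ_apply']
    exact hf _ ih

/-- The terms that are strongly normalizing when applied to any number of strongly normalizing
arguments. -/
def baseC : Set GTerm := ⋂ n : ℕ, arrC^[n] {t | Sn t}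

theorem cand_baseC : Cand baseC := by
  have hc n := cand_iterate (fun _ => cand_arrC) cand_sn n
  unfold baseC
  refine ⟨fun h => ?_, fun h h' => ?_, fun ht h => ?_, ?_⟩
  · exact (hc 0).sn (Set.mem_iInter.1 h 0)
  · exact Set.mem_iInter.2 fun n => (hc n).step (Set.mem_iInter.1 h n) h'
  · exact Set.mem_iInter.2 fun n => (hc n).of_neut ht fun t' h' => Set.mem_iInter.1 (h t' h') n
  · exact Set.mem_iInter.2 fun n => (hc n).unit

theorem app_mem_baseC {t u : GTerm} (ht : t ∈ baseC) (hu : Sn u) : .app t u ∈ baseC := by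
  refine Set.mem_iInter.2 fun n => ?_
  have := Set.mem_iInter.1 ht (n + 1)
  rw [Function.iterate_succ_apply'] at this
  exact this u hu

theorem pairC_mono {X Y : Set GTerm} (h : X ⊆ Y) : pairC X ⊆ pairC Y :=
  fun _ ht => ⟨ht.1, fun a b hab => h (ht.2 a b hab)⟩

theorem arrC_mono {X Y : Set GTerm} (h : X ⊆ Y) : arrC X ⊆ arrC Y :=
  fun _ ht u hu => h (ht u hu)

theorem sn_pair {s t : GTerm} (hs : Sn s) (ht : Sn t) : Sn (.pair s t) := by
  induction hs generalizing t with
  | intro s hs ihs =>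
    induction ht with
    | intro t ht iht =>
      refine ⟨_, fun v hv => ?_⟩
      cases inner_of_step (by simp [GTerm.spineHead]) hv with
      | pairL t h => exact ihs _ h ⟨_, ht⟩
      | pairR s h => exact iht _ h

theorem sn_pair_left {s t : GTerm} (h : Sn (.pair s t)) : Sn s := by
  generalize hr : GTerm.pair s t = r at h
  induction h generalizing s with
  | intro r _ ih =>
    subst hr
    exact ⟨_, fun s' hs => ih _ (.pairL t hs) rfl⟩

theorem pair_mem {X : Set GTerm} (hX : Cand X) {s t : GTerm} (hs : Sn s) (ht : t ∈ X) :
    .pair s t ∈ pairC X := by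
  refine ⟨sn_pair hs (hX.sn ht), fun a b hab => ?_⟩
  have key : ∀ v, Relation.ReflTransGen (Step false) (.pair s t) v →
      ∃ a b, v = .pair a b ∧ b ∈ X := by
    intro v hv
    induction hv with
    | refl => exact ⟨s, t, rfl, ht⟩
    | tail _ h ih =>
      obtain ⟨a, b, rfl, hb⟩ := ih
      cases inner_of_step (by simp [GTerm.spineHead]) h with
      | pairL t h' => exact ⟨_, _, rfl, hb⟩
      | pairR s h' => exact ⟨_, _, rfl, hX.step hb h'⟩
  obtain ⟨a', b', h, hb⟩ := key _ hab
  cases h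
  exact hb

theorem esub_mem {X : Set GTerm} (hX : Cand X) {s t : GTerm} (α : ℕ) (hs : Sn s) (ht : Sn t) :
    .esub s α t ∈ X := by
  induction hs generalizing t with
  | intro s hs ihs =>
    induction ht with
    | intro t ht iht =>
      refine hX.of_neut (by simp [GTerm.neut]) fun v hv => ?_
      cases inner_of_step (by simp [GTerm.spineHead]) hv with
      | esubL α t h => exact ihs _ h ⟨_, ht⟩
      | esubR s α h => exact iht _ h

theorem sn_of_sn_instB {s u : GTerm} {k : ℕ} (h : Sn (GTerm.instB u k s)) : Sn s := by
  generalize hs : GTerm.instB u k s = r at h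
  induction h generalizing s with
  | intro r _ ih =>
    subst hs
    exact ⟨_, fun s' hs => ih _ (hs.instB u k) rfl⟩

theorem lam_mem {X : Set GTerm} (hX : Cand X) {s : GTerm}
    (h : ∀ u, Sn u → GTerm.instB u 0 s ∈ X) : .lam s ∈ arrC X := by
  have hs : Sn s := sn_of_sn_instB (hX.sn (h _ sn_unit))
  intro u hu
  induction hs generalizing u with
  | intro s hs ihs =>
    induction hu with
    | intro u hu ihu =>
      refine hX.of_neut (by simp [GTerm.neut]) fun v hv => ?_
      cases inner_of_step (by simp [GTerm.spineHead]) hv with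
      | beta => exact h u ⟨_, hu⟩
      | appL t h' =>
        cases inner_of_step (by simp [GTerm.spineHead]) h' with
        | lamC hs' => exact ihs _ hs' (fun u hu => hX.step (h u hu) (hs'.instB u 0)) u ⟨_, hu⟩
      | appR s h' => exact ihu _ h'

theorem sn_toG (t : Term) : Sn t.toG := by
  suffices h : t.toG ∈ baseC from cand_baseC.sn h
  induction t with
  | app s t ihs iht => exact app_mem_baseC ihs (cand_baseC.sn iht)
  | _ =>
    refine cand_baseC.of_neut (by simp [Term.toG, GTerm.neut]) fun v hv => ?_
    cases inner_of_step (by simp [Term.toG, GTerm.spineHead]) hv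

theorem sn_apps_fvar {l : List GTerm} (h : ∀ z ∈ l, Sn z) : Sn (GTerm.apps (.fvar 0) l) := by
  suffices H : GTerm.apps (.fvar 0) l ∈ baseC from cand_baseC.sn H
  induction l using List.reverseRecOn with
  | nil =>
    refine cand_baseC.of_neut trivial fun v hv => ?_
    cases inner_of_step (by simp [GTerm.apps, GTerm.spineHead]) hv
  | append_singleton l z ih =>
    rw [apps_concat]
    exact app_mem_baseC (ih fun y hy => h y (by simp [hy])) (h z (by simp))

/-! ### Interpretation of formulas -/

/-- The candidate interpreting the argument type `τ*_F`. -/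
def argC : Formula → Set GTerm
  | .all _ A => pairC (argC A)
  | .ex _ A => arrC (argC A)
  | _ => baseC

/-- The candidate interpreting the output type `τ_F`. -/
def outC (F : Formula) : Set GTerm := pairC^[F.prefEx] baseC

theorem cand_argC (F : Formula) : Cand (argC F) := by
  induction F with
  | all v A ih => exact cand_pairC _
  | ex v A ih => exact cand_arrC ih
  | _ => exact cand_baseC

theorem cand_outC (F : Formula) : Cand (outC F) :=
  cand_iterate (fun X _ => cand_pairC X) cand_baseC _

theorem argC_subst (v : ℕ) (t : Term) (F : Formula) : argC (F.subst v t) = argC F := by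
  induction F with
  | all w A ih =>
    simp only [Formula.subst]
    split_ifs
    · rfl
    · simp only [argC, ih]
  | ex w A ih =>
    simp only [Formula.subst]
    split_ifs
    · rfl
    · simp only [argC, ih]
  | _ => rfl

theorem prefEx_subst (v : ℕ) (t : Term) (F : Formula) : (F.subst v t).prefEx = F.prefEx := by
  induction F with
  | all w A ih =>
    simp only [Formula.subst]
    split_ifs
    · rfl
    · simp only [Formula.prefEx, ih]
  | ex w A ih =>
    simp only [Formula.subst]
    split_ifs
    · rfl
    · simp only [Formula.prefEx, ih]
  | _ => rfl

theorem outC_subst (v : ℕ) (t : Term) (F : Formula) : outC (F.subst v t) = outC F := by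
  rw [outC, prefEx_subst, outC]

theorem outC_ex (v : ℕ) (F : Formula) : outC (.ex v F) = pairC (outC F) :=
  Function.iterate_succ_apply' _ _ _

theorem dual_dual (F : Formula) : F.dual.dual = F := by
  induction F <;> simp_all [Formula.dual]

theorem qfB_dual (F : Formula) : F.dual.qfB = F.qfB := by
  induction F <;> simp_all [Formula.dual, Formula.qfB]

theorem argC_of_qfB {F : Formula} (h : F.qfB = true) : argC F = baseC := by
  cases F <;> simp_all [Formula.qfB, argC]

theorem prefEx_of_qfB {F : Formula} (h : F.qfB = true) : F.prefEx = 0 := by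
  cases F <;> simp_all [Formula.qfB, Formula.prefEx]

theorem allPre_of_qfB {F : Formula} (h : F.qfB = true) : F.allPre = 0 := by
  cases F <;> simp_all [Formula.qfB, Formula.allPre]

theorem allPre_dual (F : Formula) : F.dual.allPre = F.exPre := by
  induction F <;> simp_all [Formula.dual, Formula.allPre, Formula.exPre]

theorem allPre_of_sigma1 {F : Formula} (h : Sigma1 F) : F.allPre = 0 := by
  cases h with
  | qf h => exact allPre_of_qfB h
  | ex _ => rfl

theorem prefEx_of_pi1 {F : Formula} (h : Pi1 F) : F.prefEx = 0 := by
  induction h with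
  | qf h => exact prefEx_of_qfB h
  | all _ ih => exact ih

theorem baseC_subset_argC_dual {F : Formula} (h : Pi1 F) : baseC ⊆ argC F.dual := by
  induction h with
  | qf h => rw [argC_of_qfB (by rwa [qfB_dual])]
  | all _ ih => exact fun t ht u hu => ih (app_mem_baseC ht hu)

theorem outC_subset_argC_dual_of_sigma1 {F : Formula} (h : Sigma1 F) : outC F ⊆ argC F.dual := by
  induction h with
  | qf h => rw [argC_of_qfB (by rwa [qfB_dual]), outC, prefEx_of_qfB h]; rfl
  | ex _ ih =>
    rw [outC_ex]
    exact pairC_mono ih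

theorem outC_subset_argC_dual {F : Formula} (h : Sigma2 F) : outC F ⊆ argC F.dual := by
  induction h with
  | pi h =>
    rw [outC, prefEx_of_pi1 h]
    exact baseC_subset_argC_dual h
  | ex _ ih =>
    rw [outC_ex]
    exact pairC_mono ih

theorem arrC_outC_subset_argC_dual {F : Formula} (h : Pi2 F) :
    arrC^[F.allPre] (outC F) ⊆ argC F.dual := by
  induction h with
  | sig h =>
    rw [allPre_of_sigma1 h]
    exact outC_subset_argC_dual_of_sigma1 h
  | all _ ih =>
    rw [Formula.allPre, Function.iterate_succ_apply']
    exact arrC_mono ih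

theorem Sigma1.sigma2 {F : Formula} (h : Sigma1 F) : Sigma2 F := by
  induction h with
  | qf h => exact .pi (.qf h)
  | ex _ ih => exact .ex ih

theorem Pi1.pi2 {F : Formula} (h : Pi1 F) : Pi2 F := by
  induction h with
  | qf h => exact .sig (.qf h)
  | all _ ih => exact .all ih

theorem Pi1.dual {F : Formula} (h : Pi1 F) : Sigma1 F.dual := by
  induction h with
  | qf h => exact .qf (by rwa [qfB_dual])
  | all _ ih => exact .ex ih

theorem Sigma1.dual {F : Formula} (h : Sigma1 F) : Pi1 F.dual := by
  induction h with
  | qf h => exact .qf (by rwa [qfB_dual])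
  | ex _ ih => exact .all ih

theorem Sigma2.dual {F : Formula} (h : Sigma2 F) : Pi2 F.dual := by
  induction h with
  | pi h => exact .sig h.dual
  | ex _ ih => exact .all ih

theorem Pi2.dual {F : Formula} (h : Pi2 F) : Sigma2 F.dual := by
  induction h with
  | sig h => exact .pi h.dual
  | all _ ih => exact .ex ih

theorem pi2_of_headAll {F : Formula} (h : Pi2 F ∨ Sigma2 F) (hF : F.headAll = true) : Pi2 F := by
  rcases h with h | h
  · exact h
  · cases h with
    | pi h => exact h.pi2
    | ex _ => cases hF

theorem sigma2_of_not_headAll {F : Formula} (h : Pi2 F ∨ Sigma2 F) (hF : ¬ F.headAll = true) :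
    Sigma2 F := by
  rcases h with h | h
  · cases h with
    | sig h => exact h.sigma2
    | all _ => exact absurd rfl hF
  · exact h

/-! ### Non-terminals are reducible -/

/-- The lists of arguments interpreting a sequent. -/
abbrev ArgsC (Γ : Sequent) (zs : List GTerm) : Prop := List.Forall₂ (fun A z => z ∈ argC A) Γ zs

theorem ArgsC.sn {Γ : Sequent} {zs : List GTerm} (h : ArgsC Γ zs) : ∀ z ∈ zs, Sn z := by
  induction h with
  | nil => simp
  | cons h _ ih =>
    rintro z (_ | ⟨_, hz⟩)
    · exact (cand_argC _).sn h
    · exact ih z hz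

theorem ArgsC.step {Γ : Sequent} {zs zs' : List GTerm} (h : ArgsC Γ zs) (hs : LStep zs zs') :
    ArgsC Γ zs' := by
  induction hs generalizing Γ with
  | head ys hs =>
    cases h with
    | cons h h' => exact .cons ((cand_argC _).step h hs) h'
  | tail z _ ih =>
    cases h with
    | cons h h' => exact .cons h (ih h')

theorem ArgsC.exists_append {Γ Δ : Sequent} {zs : List GTerm} (h : ArgsC (Γ ++ Δ) zs) :
    ∃ xs ys, zs = xs ++ ys ∧ xs.length = Γ.length ∧ ArgsC Γ xs ∧ ArgsC Δ ys := by
  induction Γ generalizing zs with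
  | nil => exact ⟨[], zs, rfl, rfl, .nil, h⟩
  | cons A Γ ih =>
    cases h with
    | cons h h' =>
      obtain ⟨xs, ys, rfl, hl, hx, hy⟩ := ih h'
      exact ⟨_ :: xs, ys, rfl, by simp [hl], .cons h hx, hy⟩

theorem argsC_append {Γ Δ : Sequent} {xs ys : List GTerm} (hx : ArgsC Γ xs) (hy : ArgsC Δ ys) :
    ArgsC (Γ ++ Δ) (xs ++ ys) := by
  induction hx with
  | nil => exact hy
  | cons h _ ih => exact .cons h ih

theorem argsC_replicate_unit (Γ : Sequent) : ArgsC Γ (List.replicate Γ.length .unit) := by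
  induction Γ with
  | nil => exact .nil
  | cons A Γ ih => exact .cons (cand_argC A).unit ih

/-- A non-terminal applied to reducible arguments lies in a candidate as soon as all results of
its production rules do. -/
theorem apps_nt_mem {X : Set GTerm} (hX : Cand X) {p : PProof} {i : ℕ}
    (h : ∀ zs, ArgsC p.1 zs → ∀ v ∈ prods p.2 i zs, v ∈ X) {zs : List GTerm}
    (hz : ArgsC p.1 zs) : GTerm.apps (.nt p i) zs ∈ X := by
  have hsn := sn_apps_fvar hz.sn
  generalize hs : GTerm.apps (.fvar 0) zs = s at hsn
  induction hsn generalizing zs with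
  | intro s _ ih =>
    subst hs
    have hl := hz.length_eq
    refine hX.of_neut ((neut_apps _ _ _).2 (by simp [GTerm.neut, hl])) fun v hv => ?_
    rcases step_apps_nt hl.ge hv with ⟨_, hv⟩ | ⟨zs', hs, rfl⟩
    · exact h zs hz v hv
    · exact ih _ (hs.step_apps _) (hz.step hs) rfl

theorem shift_zero (k : ℕ) (t : GTerm) : GTerm.shift 0 k t = t := by
  induction t generalizing k <;> simp_all [GTerm.shift]

theorem lams_mem {X : Set GTerm} (hX : Cand X) {p : PProof} {xs : List GTerm} {n : ℕ}
    {us : List GTerm} (hus : ∀ u ∈ us, Sn u)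
    (h : ∀ ws : List GTerm, (∀ w ∈ ws, Sn w) → ws.length = us.length + n →
      GTerm.apps (.nt p 0) (GTerm.tuple ws :: xs) ∈ X) :
    GTerm.lams n (GTerm.apps (.nt p 0)
      (GTerm.tuple (us.map (GTerm.shift n 0) ++ (List.range n).reverse.map .bvar) ::
        xs.map (GTerm.shift n 0))) ∈ arrC^[n] X := by
  induction n generalizing us with
  | zero =>
    have hid : GTerm.shift 0 0 = id := funext (shift_zero 0)
    simpa [hid, GTerm.lams] using h us hus rfl
  | succ n ih =>
    rw [Function.iterate_succ_apply']
    refine lam_mem (cand_iterate (fun _ => cand_arrC) hX n) fun u hu => ?_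
    have hshift (l : List GTerm) :
        (l.map (GTerm.shift (n + 1) 0)).map (GTerm.instB u n) = l.map (GTerm.shift n 0) := by
      rw [List.map_map]
      refine List.map_congr_left fun a _ => ?_
      have := instB_shift_succ (i := 0) (le_refl n) u a
      rwa [Nat.zero_add] at this
    have := @ih (us ++ [u])
      (by
        intro w hw
        rcases List.mem_append.1 hw with hw | hw
        · exact hus w hw
        · rwa [List.mem_singleton.1 hw])
      (fun ws hws hl => h ws hws (by simp at hl; omega))
    rw [instB_lams, Nat.zero_add, instB_apps, List.map_cons, instB_tuple, List.map_append, hshift,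
      hshift, List.range_succ, List.reverse_append, List.map_append, List.map_append,
      map_instB_bvars (le_refl n)]
    simpa [GTerm.instB] using this

theorem tuple_mem_argC {F : Formula} {us : List GTerm} (hus : ∀ u ∈ us, Sn u)
    (hl : us.length = F.allPre) : GTerm.tuple us ∈ argC F := by
  induction F generalizing us with
  | all v A ih =>
    cases us with
    | nil => cases hl
    | cons u us =>
      exact pair_mem (cand_argC A) (hus u (by simp))
        (ih (fun w hw => hus w (by simp [hw])) (Nat.succ.inj hl))
  | _ =>
    rw [List.length_eq_zero_iff.1 hl]
    exact (cand_argC _).unit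

theorem constSeq_mem_outC (F : Formula) : GTerm.constSeq F.prefEx ∈ outC F := by
  rw [constSeq_eq_tuple, outC]
  generalize F.prefEx = n
  induction n with
  | zero => exact cand_baseC.unit
  | succ n ih =>
    rw [Function.iterate_succ_apply']
    exact pair_mem (cand_iterate (fun X _ => cand_pairC X) cand_baseC n) (sn_toG (.fn 0)) ih

/-- The abstraction of `σ_p⁰` over the components of its first argument. -/
theorem lams_varSeq_mem {F : Formula} (hF : Pi2 F) {p : PProof} {xs : List GTerm}
    (h : ∀ z ∈ argC F, GTerm.apps (.nt p 0) (z :: xs) ∈ outC F) :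
    GTerm.lams F.allPre (GTerm.apps (.nt p 0)
      (GTerm.varSeq F.allPre :: xs.map (GTerm.shift F.allPre 0))) ∈ argC F.dual := by
  rw [varSeq_eq_tuple]
  refine arrC_outC_subset_argC_dual hF
    (lams_mem (us := []) (cand_outC F) (by simp) fun ws hws hl => ?_)
  exact h _ (tuple_mem_argC hws (by simpa using hl))

theorem comp_mem {F : Formula} (hF : Pi2 F ∨ Sigma2 F) {p q : PProof} {xs ys : List GTerm}
    (hp : ∀ z ∈ argC F, GTerm.apps (.nt p 0) (z :: xs) ∈ outC F)
    (hq : ∀ z ∈ argC F.dual, GTerm.apps (.nt q 0) (z :: ys) ∈ outC F.dual) :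
    comp F p q xs ys ∈ argC F.dual := by
  unfold comp
  split_ifs with h1 h2
  · exact (cand_argC _).unit
  · exact lams_varSeq_mem (pi2_of_headAll hF h2) hp
  · have hS := sigma2_of_not_headAll hF h2
    refine outC_subset_argC_dual hS (hp _ ?_)
    have := lams_varSeq_mem hS.dual hq
    rwa [dual_dual, allPre_dual] at this

theorem apps_nt_mem_outC {Γ : Sequent} (π : LK Γ) (hcuts : π.CutsPi2Sigma2) {i : ℕ}
    (hi : i < Γ.length) {zs : List GTerm} (hz : ArgsC Γ zs) :
    GTerm.apps (.nt ⟨Γ, π⟩ i) zs ∈ outC (Γ.getD i default) := by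
  induction π generalizing i zs with
  | ax b P ts =>
    refine apps_nt_mem (cand_outC _) (fun zs hz v hv => ?_) hz
    obtain _ | ⟨h0, _ | ⟨h1, _ | _⟩⟩ := hz
    simp only [List.length_cons, List.length_nil] at hi
    rcases (by omega : i = 0 ∨ i = 1) with rfl | rfl
    · simp only [prods, if_true, List.mem_singleton] at hv
      subst hv
      exact h1
    · simp only [prods, one_ne_zero, if_false, List.mem_singleton] at hv
      subst hv
      exact h0
  | orI A B Γ p ih =>
    refine apps_nt_mem (cand_outC _) (fun zs hz v hv => ?_) hz
    obtain _ | ⟨h0, hz⟩ := hz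
    cases i with
    | zero =>
      simp only [prods, if_true, List.mem_singleton] at hv
      subst hv
      exact (cand_outC _).unit
    | succ i =>
      simp only [prods, Nat.succ_ne_zero, if_false, List.mem_singleton] at hv
      subst hv
      exact @ih hcuts (i + 2) (by simpa using hi) _
        (.cons (cand_argC _).unit (.cons (cand_argC _).unit hz))
  | andI A B Γ Δ p q ihp ihq =>
    refine apps_nt_mem (cand_outC _) (fun zs hz v hv => ?_) hz
    obtain _ | ⟨h0, hz⟩ := hz
    obtain ⟨xs, ys, rfl, hl, hx, hy⟩ := ArgsC.exists_append hz
    have hcp : p.CutsPi2Sigma2 := fun A hA => hcuts A (List.mem_append_left _ hA)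
    have hcq : q.CutsPi2Sigma2 := fun A hA => hcuts A (List.mem_append_right _ hA)
    cases i with
    | zero =>
      simp only [prods, if_true, List.mem_singleton] at hv
      subst hv
      exact (cand_outC _).unit
    | succ i =>
      simp only [prods, Nat.succ_ne_zero, if_false, List.tail_cons, ← hl, List.take_left,
        List.drop_left, Nat.succ_le_iff] at hv
      rw [hl] at hv
      split_ifs at hv with h
      · rw [List.mem_singleton] at hv
        subst hv
        have := @ihp hcp (i + 1) (by simpa using h) _ (.cons (cand_argC _).unit hx)
        rw [List.getD_cons_succ] at this ⊢
        rwa [List.getD_append _ _ _ _ h]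
      · rw [List.mem_singleton, Nat.succ_sub (Nat.not_lt.1 h)] at hv
        subst hv
        have := @ihq hcq (i - Γ.length + 1)
          (by simp only [List.length_cons, List.length_append] at hi ⊢; omega) _
          (.cons (cand_argC _).unit hy)
        rw [List.getD_cons_succ] at this ⊢
        rwa [List.getD_append_right _ _ _ _ (Nat.not_lt.1 h)]
  | allI v α A Γ p ih =>
    refine apps_nt_mem (cand_outC _) (fun zs hz v hv => ?_) hz
    obtain _ | ⟨h0, hz⟩ := hz
    simp only [prods] at hv
    split at hv
    · rename_i z₀ z₁ ys heq
      cases heq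
      simp only [List.mem_singleton] at hv
      subst hv
      have h1 := sn_pair_left h0.1
      refine esub_mem (cand_outC _) _ ((cand_outC _).sn (@ih hcuts i (by simpa using hi) _
        (.cons ?_ hz))) h1
      rw [argC_subst]
      exact h0.2 _ _ .refl
    · cases hv
  | exI w t A Γ p ih =>
    refine apps_nt_mem (cand_outC _) (fun zs hz v hv => ?_) hz
    obtain _ | ⟨h0, hz⟩ := hz
    have hz' : ArgsC (A.subst w t :: Γ) _ :=
      .cons (by rw [argC_subst]; exact h0 _ (sn_toG t)) hz
    cases i with
    | zero =>
      simp only [prods, if_true, List.mem_singleton] at hv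
      subst hv
      have := @ih hcuts 0 (by simp) _ hz'
      rw [List.getD_cons_zero, outC_subst] at this
      rw [List.getD_cons_zero, outC_ex]
      exact pair_mem (cand_outC _) (sn_toG t) this
    | succ i =>
      simp only [prods, Nat.succ_ne_zero, if_false, List.mem_singleton] at hv
      subst hv
      exact @ih hcuts (i + 1) (by simpa using hi) _ hz'
  | cut A Γ Δ p q ihp ihq =>
    refine apps_nt_mem (cand_outC _) (fun zs hz v hv => ?_) hz
    obtain ⟨xs, ys, rfl, hl, hx, hy⟩ := ArgsC.exists_append hz
    have hcp : p.CutsPi2Sigma2 :=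
      fun A hA => hcuts A (List.mem_cons_of_mem _ (List.mem_append_left _ hA))
    have hcq : q.CutsPi2Sigma2 :=
      fun A hA => hcuts A (List.mem_cons_of_mem _ (List.mem_append_right _ hA))
    have hA : Pi2 A ∨ Sigma2 A := hcuts A (List.mem_cons_self ..)
    have hp0 : ∀ z ∈ argC A, GTerm.apps (.nt ⟨_, p⟩ 0) (z :: xs) ∈ outC A :=
      fun z hz => @ihp hcp 0 (by simp) _ (.cons hz hx)
    have hq0 : ∀ z ∈ argC A.dual, GTerm.apps (.nt ⟨_, q⟩ 0) (z :: ys) ∈ outC A.dual :=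
      fun z hz => @ihq hcq 0 (by simp) _ (.cons hz hy)
    simp only [prods, ← hl, List.take_left, List.drop_left] at hv
    rw [hl] at hv
    split_ifs at hv with h
    · rw [List.mem_singleton] at hv
      subst hv
      have hc := comp_mem (hA.symm.imp Sigma2.dual Pi2.dual) hq0 (by rwa [dual_dual])
      rw [dual_dual] at hc
      have := @ihp hcp (i + 1) (by simpa using h) _ (.cons hc hx)
      rw [List.getD_cons_succ] at this
      rwa [List.getD_append _ _ _ _ h]
    · rw [List.mem_singleton] at hv
      subst hv
      have := @ihq hcq (i - Γ.length + 1)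
        (by simp only [List.length_cons, List.length_append] at hi ⊢; omega) _
        (.cons (comp_mem hA hp0 hq0) hy)
      rw [List.getD_cons_succ] at this
      rwa [List.getD_append_right _ _ _ _ (Nat.not_lt.1 h)]
  | wk A Γ p ih =>
    refine apps_nt_mem (cand_outC _) (fun zs hz v hv => ?_) hz
    obtain _ | ⟨h0, hz⟩ := hz
    cases i with
    | zero =>
      simp only [prods, if_true, List.mem_singleton] at hv
      subst hv
      exact constSeq_mem_outC A
    | succ i =>
      simp only [prods, Nat.succ_ne_zero, if_false, List.mem_singleton] at hv
      subst hv
      exact @ih hcuts i (by simpa using hi) _ hz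
  | ctr A Γ p ih =>
    refine apps_nt_mem (cand_outC _) (fun zs hz v hv => ?_) hz
    obtain _ | ⟨h0, hz⟩ := hz
    have hz' : ArgsC (A :: A :: Γ) _ := .cons h0 (.cons h0 hz)
    have hsucc := @ih hcuts (i + 1) (by simpa using hi) _ hz'
    cases i with
    | zero =>
      simp only [prods, if_true, List.mem_append, List.mem_singleton] at hv
      rcases hv with rfl | rfl
      · exact @ih hcuts 0 (by simp) _ hz'
      · exact hsucc
    | succ i =>
      simp only [prods, Nat.succ_ne_zero, if_false, List.nil_append, List.mem_singleton] at hv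
      subst hv
      exact hsucc
  | perm A B Γ Δ p ih =>
    refine apps_nt_mem (cand_outC _) (fun zs hz v hv => ?_) hz
    obtain ⟨xs, ys, rfl, hl, hx, hy⟩ := ArgsC.exists_append hz
    obtain _ | ⟨h0, _ | ⟨h1, hy⟩⟩ := hy
    simp only [prods, ← hl, List.take_left, List.drop_left] at hv
    rw [hl, List.mem_singleton] at hv
    subst hv
    have hz' := argsC_append hx (List.Forall₂.cons h1 (List.Forall₂.cons h0 hy))
    simp only [List.length_append, List.length_cons] at hi
    by_cases h : i < Γ.length
    · have := @ih hcuts i (by simp only [List.length_append, List.length_cons]; omega) _ hz'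
      rw [if_neg (by omega), if_neg (by omega)]
      rw [List.getD_append _ _ _ _ h] at this ⊢
      exact this
    · obtain ⟨j, rfl⟩ := Nat.exists_eq_add_of_le (Nat.not_lt.1 h)
      have key (k : ℕ) (hk : k < Δ.length + 2) :=
        @ih hcuts (Γ.length + k)
          (by simp only [List.length_append, List.length_cons]; omega) _ hz'
      simp only [List.getD_append_right _ _ _ _ (Nat.le_add_right _ _),
        Nat.add_sub_cancel_left] at key ⊢
      match j with
      | 0 => simpa using key 1 (by omega)
      | 1 => simpa using key 0 (by omega)
      | j + 2 =>
        rw [if_neg (by omega), if_neg (by omega)]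
        exact key (j + 2) (by omega)

theorem finite_reach {t : GTerm} (h : Sn t) :
    {v | Relation.ReflTransGen (Step false) t v}.Finite := by
  induction h with
  | intro t _ ih =>
    refine (((finite_step t).biUnion ih).insert t).subset fun v hv => ?_
    rcases Relation.ReflTransGen.cases_head hv with rfl | ⟨s, hs, hv⟩
    · exact .inl rfl
    · exact .inr (Set.mem_biUnion hs hv)

end PGram

open PGram in
/-- **Lemma 2.** For any regular proof `π` of a prenex Σ₁ sequent with prenex
Π₂/Σ₂ cuts, the language `L(π)` is finite. -/
theorem language_finite {Γ : Sequent} (π : LK Γ) (hreg : π.Regular)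
    (hΓ : ∀ A ∈ Γ, Sigma1 A) (hcuts : π.CutsPi2Sigma2) :
    (L ⟨_, π⟩).Finite := by
  refine ((Set.finite_lt_nat Γ.length).biUnion fun i hi =>
    (finite_reach ((cand_outC _).sn (apps_nt_mem_outC π hcuts hi
      (argsC_replicate_unit Γ)))).image fun T => (i, (T.evalE.toSeq).getD [])).subset ?_
  rintro ⟨i, l⟩ ⟨hi, T, hT, hl⟩
  exact Set.mem_biUnion hi ⟨T, hT.1, by simp [hl]⟩
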